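/- arXiv:1702.00876 — 8 statements merged into one kernel-verified Lean document; each statement's English description precedes it below -/
import Mathlib

section
/- Let C be a semisimple category. Then for each morphism f : X → Y in C there exist objects A, B, C' and isomorphisms α : X → A ⊕ B and β : Y → C' ⊕ B such that β ∘ f = (the morphism A ⊕ B → C' ⊕ B given by the matrix with entries 0 : A → C', 0 : A → B is irrelevant, i.e., the biproduct map of 0 : A → C' and id : B → B) ∘ α; in other words, every morphism in C is, up to composing with isomorphisms on both sides, of the form 0 ⊕ id_B : A ⊕ B → C' ⊕ B. -/
open CategoryTheory CategoryTheory.Limits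

/-- If every morphism factors as a split epimorphism followed by a split monomorphism, then
all idempotents split. -/
theorem isIdempotentComplete_of_splitEpi_splitMono_factorisation {C : Type*} [Category C]
    (hss : ∀ {X Y : C} (f : X ⟶ Y), ∃ (Z : C) (g : X ⟶ Z) (h : Z ⟶ Y),
      IsSplitEpi g ∧ IsSplitMono h ∧ f = g ≫ h) :
    IsIdempotentComplete C where
  idempotents_split X p hp := by
    obtain ⟨Z, g, h, hg, hh, rfl⟩ := hss p
    refine ⟨Z, h, g, ?_, rfl⟩
    rw [← cancel_epi g, ← cancel_mono h]
    simpa using hp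

/-- In an idempotent complete preadditive category, the target of a split epimorphism is a
direct summand of its source, compatibly with a given section. -/
theorem exists_iso_biprod_of_section_comp_eq_id {C : Type*} [Category C] [Preadditive C]
    [HasBinaryBiproducts C] [IsIdempotentComplete C] {X Z : C} {g : X ⟶ Z} {s : Z ⟶ X}
    (hsg : s ≫ g = 𝟙 Z) :
    ∃ (A : C) (e : X ≅ A ⊞ Z), e.hom ≫ biprod.snd = g ∧ s ≫ e.hom = biprod.inr := by
  have hgs : (g ≫ s) ≫ g ≫ s = g ≫ s := by simp [reassoc_of% hsg]
  obtain ⟨A, i, p, hip, hpi⟩ := IsIdempotentComplete.idempotents_split X _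
    (Idempotents.idem_of_id_sub_idem (g ≫ s) hgs)
  have : IsSplitEpi p := .mk' ⟨i, hip⟩
  have : IsSplitMono i := .mk' ⟨p, hip⟩
  have hig : i ≫ g = 0 := by
    rw [← cancel_epi p, reassoc_of% hpi]
    simp [hsg]
  have hsp : s ≫ p = 0 := by
    rw [← cancel_mono i, Category.assoc, hpi]
    simp [reassoc_of% hsg]
  refine ⟨A, ⟨biprod.lift p g, biprod.desc i s, ?_, ?_⟩, ?_, ?_⟩
  · simp [biprod.lift_desc, hpi]
  · ext <;> simp [hip, hig, hsp, hsg]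
  · simp
  · ext <;> simp [hsp, hsg]

/-- In a semisimple category (an additive category in which every morphism factors as a
split epimorphism followed by a split monomorphism), every morphism `f : X ⟶ Y` is,
up to composing with isomorphisms on both sides, of the form
`0 ⊕ id : A ⊞ B ⟶ C' ⊞ B`. -/
theorem semisimple_morphism_normal_form {C : Type*} [Category C] [Preadditive C]
    [HasFiniteBiproducts C] [HasBinaryBiproducts C]
    (hss : ∀ {X Y : C} (f : X ⟶ Y), ∃ (Z : C) (g : X ⟶ Z) (h : Z ⟶ Y),
      IsSplitEpi g ∧ IsSplitMono h ∧ f = g ≫ h)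
    {X Y : C} (f : X ⟶ Y) :
    ∃ (A B C' : C) (α : X ≅ A ⊞ B) (β : Y ≅ C' ⊞ B),
      f ≫ β.hom = α.hom ≫ biprod.map (0 : A ⟶ C') (𝟙 B) := by
  have := isIdempotentComplete_of_splitEpi_splitMono_factorisation hss
  obtain ⟨Z, g, h, hg, hh, rfl⟩ := hss f
  obtain ⟨A, α, hα, -⟩ := exists_iso_biprod_of_section_comp_eq_id (IsSplitEpi.id g)
  obtain ⟨C', β, -, hβ⟩ := exists_iso_biprod_of_section_comp_eq_id (IsSplitMono.id h)
  refine ⟨A, Z, C', α, β, ?_⟩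
  rw [Category.assoc, hβ, ← hα]
  ext <;> simp
end

section
/- Let T be a pretriangulated category with shift Σ, let d ≥ 2, and let C be a full subcategory of T that is d-rigid and closed under Σ^d. Suppose given objects C_1, …, C_{d+2} of C, objects Y_2, …, Y_d of T, and distinguished triangles C_1 →^{α_1} C_2 →^{β_2} Y_2 →^{γ_2} Σ C_1; Y_i →^{δ_i} C_{i+1} →^{β_{i+1}} Y_{i+1} →^{γ_{i+1}} Σ Y_i for 2 ≤ i ≤ d−1; and Y_d →^{δ_d} C_{d+1} →^{α_{d+1}} C_{d+2} →^{γ} Σ Y_d. Define α_i = δ_i ∘ β_i for 2 ≤ i ≤ d, and α_{d+2} : C_{d+2} → Σ^d C_1 as the composite Σ^{d−1}(γ_2) ∘ Σ^{d−2}(γ_3) ∘ ⋯ ∘ Σ(γ_d) ∘ γ. Then for every object A of C, the sequence of abelian groups Hom(A, C_1) → Hom(A, C_2) → ⋯ → Hom(A, C_{d+1}) → Hom(A, C_{d+2}) → Hom(A, Σ^d C_1) → Hom(A, Σ^d C_2), with maps induced by postcomposition with α_1, …, α_{d+1}, α_{d+2}, and Σ^d α_1, is exact at each of the terms Hom(A,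 C_2), …, Hom(A, C_{d+2}), Hom(A, Σ^d C_1). -/
open CategoryTheory Category Limits Pretriangulated

/-- The map `Hom(A, X⟦n⟧) → Hom(A, Y⟦n⟧)` induced by `f : X ⟶ Y`. -/
abbrev shiftPostcomp {T : Type*} [Category T] [Preadditive T] [HasShift T ℤ]
    (A : T) {X Y : T} (f : X ⟶ Y) (n : ℤ) : (A ⟶ X⟦n⟧) →+ (A ⟶ Y⟦n⟧) :=
  Preadditive.rightComp A (f⟦n⟧')

section Shift

variable {T : Type*} [Category T] [Preadditive T] [HasShift T ℤ] (A : T)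

lemma shiftPostcomp_comp {X Y Z : T} (f : X ⟶ Y) (g : Y ⟶ Z) (n : ℤ) :
    shiftPostcomp A (f ≫ g) n = (shiftPostcomp A g n).comp (shiftPostcomp A f n) := by
  ext x
  simp [Preadditive.rightComp]

lemma shiftPostcomp_bijective {X Y : T} (e : X ⟶ Y) [IsIso e] (n : ℤ) :
    Function.Bijective (shiftPostcomp A e n) :=
  ⟨fun x y h ↦ (cancel_mono (e⟦n⟧')).1 h,
    fun y ↦ ⟨y ≫ inv (e⟦n⟧'), by simp [Preadditive.rightComp]⟩⟩

/-- The identification `Hom(A, X⟦m⟧⟦n⟧) ≃ Hom(A, X⟦k⟧)` for `m + n = k`. -/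
def shiftHomEquiv (X : T) (m n k : ℤ) (h : m + n = k) : (A ⟶ X⟦m⟧⟦n⟧) ≃+ (A ⟶ X⟦k⟧) where
  toFun f := f ≫ (shiftFunctorAdd' T m n k h).inv.app X
  invFun f := f ≫ (shiftFunctorAdd' T m n k h).hom.app X
  left_inv f := by simp
  right_inv f := by simp
  map_add' f g := by simp

lemma shiftHomEquiv_shiftPostcomp {X Y : T} (f : X ⟶ Y) (m n k : ℤ) (h : m + n = k)
    (x : A ⟶ X⟦m⟧⟦n⟧) :
    shiftHomEquiv A Y m n k h (shiftPostcomp A (f⟦m⟧') n x) =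
      shiftPostcomp A f k (shiftHomEquiv A X m n k h x) := by
  have := (shiftFunctorAdd' T m n k h).inv.naturality f
  dsimp at this
  simp [shiftHomEquiv, Preadditive.rightComp, this]

lemma shiftPostcomp_shift_injective_iff {X Y : T} (f : X ⟶ Y) (m n k : ℤ) (h : m + n = k) :
    Function.Injective (shiftPostcomp A (f⟦m⟧') n) ↔
      Function.Injective (shiftPostcomp A f k) := by
  rw [← (shiftHomEquiv A Y m n k h).injective.of_comp_iff,
    ← Function.Injective.of_comp_iff' (shiftPostcomp A f k) (shiftHomEquiv A X m n k h).bijective]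
  exact iff_of_eq (congrArg _ (funext (shiftHomEquiv_shiftPostcomp A f m n k h)))

lemma shiftPostcomp_shift_exact_iff {X Y Z : T} (f : X ⟶ Y) (g : Y ⟶ Z) (m n k : ℤ)
    (h : m + n = k) :
    Function.Exact (shiftPostcomp A (f⟦m⟧') n) (shiftPostcomp A (g⟦m⟧') n) ↔
      Function.Exact (shiftPostcomp A f k) (shiftPostcomp A g k) :=
  (Function.Exact.iff_of_ladder_addEquiv (e₁ := shiftHomEquiv A X m n k h)
    (e₂ := shiftHomEquiv A Y m n k h) (e₃ := shiftHomEquiv A Z m n k h)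
    (by ext x; exact (shiftHomEquiv_shiftPostcomp A f m n k h x).symm)
    (by ext x; exact (shiftHomEquiv_shiftPostcomp A g m n k h x).symm)).symm

lemma subsingleton_hom_shift_iff (X : T) (m n k : ℤ) (h : m + n = k) :
    Subsingleton (A ⟶ X⟦m⟧⟦n⟧) ↔ Subsingleton (A ⟶ X⟦k⟧) :=
  (shiftHomEquiv A X m n k h).toEquiv.subsingleton_congr

lemma exact_shiftPostcomp_zero_iff {X Y Z : T} (f : X ⟶ Y) (g : Y ⟶ Z) :
    Function.Exact (shiftPostcomp A f 0) (shiftPostcomp A g 0) ↔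
      ∀ x : A ⟶ Y, x ≫ g = 0 ↔ ∃ y : A ⟶ X, y ≫ f = x := by
  let e (W : T) : (A ⟶ W⟦(0 : ℤ)⟧) ≃+ (A ⟶ W) :=
    { toFun := fun x ↦ x ≫ (shiftFunctorZero T ℤ).hom.app W
      invFun := fun x ↦ x ≫ (shiftFunctorZero T ℤ).inv.app W
      left_inv := fun x ↦ by simp
      right_inv := fun x ↦ by simp
      map_add' := fun x y ↦ by simp }
  exact (Function.Exact.iff_of_ladder_addEquiv (e₁ := e X) (e₂ := e Y) (e₃ := e Z)
    (g₁₂ := Preadditive.rightComp A f) (g₂₃ := Preadditive.rightComp A g)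
    (by ext x; simp [e, Preadditive.rightComp])
    (by ext x; simp [e, Preadditive.rightComp])).symm

lemma shiftPostcomp_injective_of_recurrence {W X Y : T} (u : W ⟶ X⟦(1 : ℤ)⟧) {a b c : ℤ}
    (t : X ⟶ Y⟦a⟧) (h : a + 1 = b) (hb : b = c) (e : Y⟦b⟧ = Y⟦c⟧) (n k : ℤ) (hn : 1 + n = k)
    (hu : Function.Injective (shiftPostcomp A u n))
    (ht : Function.Injective (shiftPostcomp A t k)) :
    Function.Injective (shiftPostcomp A
      (u ≫ t⟦(1 : ℤ)⟧' ≫ (shiftFunctorAdd' T a 1 b h).inv.app Y ≫ eqToHom e) n) := by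
  subst hb
  simp only [shiftPostcomp_comp, AddMonoidHom.coe_comp]
  exact (((shiftPostcomp_bijective A _ n).1.comp (shiftPostcomp_bijective A _ n).1).comp
    ((shiftPostcomp_shift_injective_iff A t 1 n k hn).2 ht)).comp hu

lemma shiftPostcomp_exact_of_recurrence {W X Y Z : T} (u : W ⟶ X⟦(1 : ℤ)⟧) {a b c : ℤ}
    (t : X ⟶ Y⟦a⟧) (f : Y ⟶ Z) (h : a + 1 = b) (hb : b = c) (e : Y⟦b⟧ = Y⟦c⟧) (n k : ℤ)
    (hn : 1 + n = k) (hu : Function.Surjective (shiftPostcomp A u n))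
    (ht : Function.Exact (shiftPostcomp A t k) (shiftPostcomp A (f⟦a⟧') k)) :
    Function.Exact (shiftPostcomp A
      (u ≫ t⟦(1 : ℤ)⟧' ≫ (shiftFunctorAdd' T a 1 b h).inv.app Y ≫ eqToHom e) n)
      (shiftPostcomp A (f⟦c⟧') n) := by
  subst hb
  rw [← shiftPostcomp_shift_exact_iff A t (f⟦a⟧') 1 n k hn] at ht
  let p (V : T) := AddEquiv.ofBijective
    (shiftPostcomp A ((shiftFunctorAdd' T a 1 b h).inv.app V) n) (shiftPostcomp_bijective A _ n)
  have hp : Function.Exact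
      (shiftPostcomp A (t⟦(1 : ℤ)⟧' ≫ (shiftFunctorAdd' T a 1 b h).inv.app Y) n)
      (shiftPostcomp A (f⟦b⟧') n) := by
    refine (Function.Exact.iff_of_ladder_addEquiv (e₁ := AddEquiv.refl _) (e₂ := p Y)
      (e₃ := p Z) ?_ ?_).2 ht
    · ext x
      simp [p, Preadditive.rightComp]
    · have := (shiftFunctorAdd' T a 1 b h).inv.naturality f
      dsimp at this
      ext x
      simp [p, Preadditive.rightComp, ← Functor.map_comp, this]
  rw [eqToHom_refl, comp_id, shiftPostcomp_comp]
  intro x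
  rw [hp x]
  simp only [AddMonoidHom.coe_comp, hu.range_comp]

variable {A}

lemma shiftPostcomp_injective_of_exact {X Y Z : T} {a : X ⟶ Y} {b : Y ⟶ Z} {n : ℤ}
    (hab : Function.Exact (shiftPostcomp A a n) (shiftPostcomp A b n))
    [Subsingleton (A ⟶ X⟦n⟧)] : Function.Injective (shiftPostcomp A b n) := by
  rw [injective_iff_map_eq_zero]
  intro x hx
  obtain ⟨y, rfl⟩ := (hab x).1 hx
  rw [Subsingleton.elim y 0, map_zero]

lemma shiftPostcomp_surjective_of_exact {X Y Z : T} {a : X ⟶ Y} {b : Y ⟶ Z} {n : ℤ}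
    (hab : Function.Exact (shiftPostcomp A a n) (shiftPostcomp A b n))
    [Subsingleton (A ⟶ Z⟦n⟧)] : Function.Surjective (shiftPostcomp A a n) :=
  fun x ↦ (hab x).1 (Subsingleton.elim _ _)

lemma subsingleton_of_exact {X Y Z : T} {a : X ⟶ Y} {b : Y ⟶ Z} {n : ℤ}
    (hab : Function.Exact (shiftPostcomp A a n) (shiftPostcomp A b n))
    (hX : Subsingleton (A ⟶ X⟦n⟧)) (hZ : Subsingleton (A ⟶ Z⟦n⟧)) :
    Subsingleton (A ⟶ Y⟦n⟧) :=
  (shiftPostcomp_injective_of_exact hab).subsingleton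

lemma shiftPostcomp_exact_of_surjective_injective {V W X Y Z : T} {p : V ⟶ W} {a : W ⟶ X}
    {b : X ⟶ Y} {q : Y ⟶ Z} {n : ℤ}
    (hab : Function.Exact (shiftPostcomp A a n) (shiftPostcomp A b n))
    (hp : Function.Surjective (shiftPostcomp A p n))
    (hq : Function.Injective (shiftPostcomp A q n)) :
    Function.Exact (shiftPostcomp A (p ≫ a) n) (shiftPostcomp A (b ≫ q) n) := by
  intro x
  rw [shiftPostcomp_comp, shiftPostcomp_comp, AddMonoidHom.coe_comp, AddMonoidHom.coe_comp,
    hp.range_comp, ← hab x]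
  exact map_eq_zero_iff _ hq

/-- If `Hom(X, Y⟦i⟧) = 0` for `1 ≤ i ≤ d - 1` on a class closed under `Σ^d`, then
`Hom(X, Y⟦n⟧) = 0` also holds for `-(d - 1) ≤ n ≤ -1`. -/
lemma subsingleton_hom_shift_of_rigid {S : Set T} {d : ℕ}
    (hrigid : ∀ X ∈ S, ∀ Y ∈ S, ∀ i : ℤ, 1 ≤ i → i ≤ (d : ℤ) - 1 → ∀ f : X ⟶ Y⟦i⟧, f = 0)
    (hclosed : ∀ X ∈ S, (X⟦(d : ℤ)⟧) ∈ S) {X Y : T} (hX : X ∈ S) (hY : Y ∈ S) {n : ℤ}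
    (hn : n ≠ 0) (hn₁ : -(d : ℤ) < n) (hn₂ : n < d) : Subsingleton (X ⟶ Y⟦n⟧) := by
  rcases lt_or_gt_of_ne hn with hneg | hpos
  · refine subsingleton_of_forall_eq 0 fun f ↦ (shiftFunctor T (d : ℤ)).map_injective ?_
    have : Subsingleton (X⟦(d : ℤ)⟧ ⟶ Y⟦n⟧⟦(d : ℤ)⟧) :=
      (subsingleton_hom_shift_iff _ Y n d _ rfl).2 (subsingleton_of_forall_eq 0
        (hrigid _ (hclosed X hX) Y hY _ (by lia) (by lia)))
    exact Subsingleton.elim _ _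
  · exact subsingleton_of_forall_eq 0 (hrigid X hX Y hY n (by lia) (by lia))

end Shift

section Triangle

variable {T : Type*} [Category T] [Preadditive T] [HasZeroObject T] [HasShift T ℤ]
  [∀ n : ℤ, (shiftFunctor T n).Additive] [Pretriangulated T] (A : T)
  {X₁ X₂ X₃ : T} {f : X₁ ⟶ X₂} {g : X₂ ⟶ X₃} {h : X₃ ⟶ X₁⟦(1 : ℤ)⟧}

lemma shiftPostcomp_exact₂ (hT : Triangle.mk f g h ∈ distTriang T) (n : ℤ) :
    Function.Exact (shiftPostcomp A f n) (shiftPostcomp A g n) := by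
  intro x
  constructor
  · intro hx
    obtain ⟨y : A ⟶ X₁⟦n⟧, hy : x = y ≫ (n.negOnePow • f⟦n⟧')⟩ :=
      Triangle.coyoneda_exact₂ _ (Triangle.shift_distinguished _ hT n) x (by
      replace hx : x ≫ g⟦n⟧' = 0 := hx
      change x ≫ (n.negOnePow • g⟦n⟧') = 0
      simp [hx])
    refine ⟨n.negOnePow • y, ?_⟩
    simp [Preadditive.rightComp, hy]
  · rintro ⟨y, rfl⟩
    have : f ≫ g = 0 := comp_distTriang_mor_zero₁₂ _ hT
    simp [Preadditive.rightComp, ← Functor.map_comp, this]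

lemma shiftPostcomp_exact₃ (hT : Triangle.mk f g h ∈ distTriang T) (n : ℤ) :
    Function.Exact (shiftPostcomp A g n) (shiftPostcomp A h n) :=
  shiftPostcomp_exact₂ A (rot_of_distTriang _ hT) n

lemma shiftPostcomp_exact₁ (hT : Triangle.mk f g h ∈ distTriang T) (n : ℤ) :
    Function.Exact (shiftPostcomp A h n) (shiftPostcomp A (f⟦(1 : ℤ)⟧') n) := by
  have key : Function.Exact (shiftPostcomp A h n) (shiftPostcomp A (-f⟦(1 : ℤ)⟧') n) :=
    shiftPostcomp_exact₃ A (rot_of_distTriang _ hT) n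
  intro x
  rw [← key x]
  simp [Preadditive.rightComp]

end Triangle

set_option maxHeartbeats 1000000 in
/-- Let `T` be a pretriangulated category, `d ≥ 2`, and `S` (the class of objects of) a
full subcategory of `T` that is `d`-rigid and closed under `Σ^d`.  Given objects
`Cobj 1, …, Cobj (d+2)` of `S`, objects `Y 2, …, Y d` of `T` and distinguished triangles
`Cobj 1 → Cobj 2 → Y 2 → Σ (Cobj 1)`,
`Y i → Cobj (i+1) → Y (i+1) → Σ (Y i)` (`2 ≤ i ≤ d-1`) and
`Y d → Cobj (d+1) → Cobj (d+2) → Σ (Y d)`,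
set `α i = β i ≫ δ i` for `2 ≤ i ≤ d` and let
`αlast : Cobj (d+2) ⟶ (Cobj 1)⟦d⟧` be the composite
`Σ^{d-1} γ₂ ∘ Σ^{d-2} γ₃ ∘ ⋯ ∘ Σ γ_d ∘ γ` (encoded via the family `θ` of partial
composites, determined by its recurrence `hθ0`, `hθ`, `hαlast`).  Then for every `A ∈ S`
the sequence `Hom(A, Cobj 1) → ⋯ → Hom(A, Cobj (d+2)) → Hom(A, (Cobj 1)⟦d⟧)
→ Hom(A, (Cobj 2)⟦d⟧)` is exact at every intermediate term. -/
theorem hom_sequence_exact_of_triangles {T : Type*} [Category T] [Preadditive T]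
    [HasZeroObject T] [HasShift T ℤ] [∀ n : ℤ, (shiftFunctor T n).Additive]
    [Pretriangulated T]
    (S : Set T) (d : ℕ) (hd : 2 ≤ d)
    (hrigid : ∀ X ∈ S, ∀ Y ∈ S, ∀ i : ℤ, 1 ≤ i → i ≤ (d : ℤ) - 1 →
      ∀ f : X ⟶ Y⟦i⟧, f = 0)
    (hclosed : ∀ X ∈ S, (X⟦(d : ℤ)⟧) ∈ S)
    (Cobj : ℕ → T) (hCobj : ∀ i, 1 ≤ i → i ≤ d + 2 → Cobj i ∈ S)
    (Y : ℕ → T)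
    (α : ∀ i : ℕ, Cobj i ⟶ Cobj (i + 1))
    (β : ∀ i : ℕ, Cobj i ⟶ Y i)
    (δ : ∀ i : ℕ, Y i ⟶ Cobj (i + 1))
    (γfam : ∀ i : ℕ, Y i ⟶ (Y (i - 1))⟦(1 : ℤ)⟧)
    (γ₂ : Y 2 ⟶ (Cobj 1)⟦(1 : ℤ)⟧)
    (γ : Cobj (d + 2) ⟶ (Y d)⟦(1 : ℤ)⟧)
    (htri1 : Triangle.mk (α 1) (β 2) γ₂ ∈ distTriang T)
    (htri : ∀ i, 2 ≤ i → i ≤ d - 1 →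
      Triangle.mk (δ i) (β (i + 1)) (γfam (i + 1)) ∈ distTriang T)
    (htriLast : Triangle.mk (δ d) (α (d + 1)) γ ∈ distTriang T)
    (hα : ∀ i, 2 ≤ i → i ≤ d → α i = β i ≫ δ i)
    -- the partial composites `θ j = Σ^j γ₂ ∘ Σ^{j-1} γ₃ ∘ ⋯ ∘ γ_{j+2}`
    (θ : ∀ j : ℕ, Y (j + 2) ⟶ (Cobj 1)⟦(j : ℤ) + 1⟧)
    (hθ0 : θ 0 = γ₂ ≫ eqToHom (by norm_num))
    (hθ : ∀ j : ℕ, j + 3 ≤ d →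
      θ (j + 1) = γfam (j + 3) ≫ (θ j)⟦(1 : ℤ)⟧' ≫
        (shiftFunctorAdd' T ((j : ℤ) + 1) 1 ((j : ℤ) + 2) (by ring)).inv.app (Cobj 1) ≫
        eqToHom (by rw [show ((j : ℤ) + 2) = ((j + 1 : ℕ) : ℤ) + 1 by push_cast; ring]))
    -- `αlast = Σ^{d-1} γ₂ ∘ Σ^{d-2} γ₃ ∘ ⋯ ∘ Σ γ_d ∘ γ`
    (αlast : Cobj (d + 2) ⟶ (Cobj 1)⟦(d : ℤ)⟧)
    (hαlast : αlast = γ ≫ eqToHom (by rw [show d - 2 + 2 = d from by omega]) ≫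
      (θ (d - 2))⟦(1 : ℤ)⟧' ≫
      (shiftFunctorAdd' T (((d - 2 : ℕ) : ℤ) + 1) 1 (((d - 2 : ℕ) : ℤ) + 2)
        (by ring)).inv.app (Cobj 1) ≫
      eqToHom (by rw [show (((d - 2 : ℕ) : ℤ) + 2) = (d : ℤ) from by omega])) :
    ∀ A ∈ S,
      (∀ i, 1 ≤ i → i ≤ d → ∀ g : A ⟶ Cobj (i + 1),
        (g ≫ α (i + 1) = 0 ↔ ∃ g' : A ⟶ Cobj i, g' ≫ α i = g)) ∧
      (∀ g : A ⟶ Cobj (d + 2),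
        (g ≫ αlast = 0 ↔ ∃ g' : A ⟶ Cobj (d + 1), g' ≫ α (d + 1) = g)) ∧
      (∀ g : A ⟶ (Cobj 1)⟦(d : ℤ)⟧,
        (g ≫ (α 1)⟦(d : ℤ)⟧' = 0 ↔ ∃ g' : A ⟶ Cobj (d + 2), g' ≫ αlast = g)) := by
  intro A hA
  have hC : ∀ j, 1 ≤ j → j ≤ d + 2 → ∀ n : ℤ, n ≠ 0 → -(d : ℤ) < n → n < d →
      Subsingleton (A ⟶ (Cobj j)⟦n⟧) := fun j h₁ h₂ n hn h₃ h₄ ↦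
    subsingleton_hom_shift_of_rigid hrigid hclosed hA (hCobj j h₁ h₂) hn h₃ h₄
  have hYpos : ∀ i, 2 ≤ i → i ≤ d → ∀ n : ℤ, 1 ≤ n → n + i ≤ d →
      Subsingleton (A ⟶ (Y i)⟦n⟧) := by
    intro i hi
    induction i, hi using Nat.le_induction with
    | base =>
      intro _ n hn hnd
      exact subsingleton_of_exact (shiftPostcomp_exact₃ A htri1 n)
        (hC 2 (by lia) (by lia) n (by lia) (by lia) (by lia))
        ((subsingleton_hom_shift_iff A _ 1 n _ rfl).2
          (hC 1 (by lia) (by lia) _ (by lia) (by lia) (by lia)))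
    | succ i hi ih =>
      intro hid n hn hnd
      exact subsingleton_of_exact (shiftPostcomp_exact₃ A (htri i hi (by lia)) n)
        (hC (i + 1) (by lia) (by lia) n (by lia) (by lia) (by lia))
        ((subsingleton_hom_shift_iff A _ 1 n _ rfl).2 (ih (by lia) _ (by lia) (by lia)))
  have hYneg : ∀ i, i ≤ d → 2 ≤ i → ∀ n : ℤ, n ≤ -1 → 2 - n ≤ i →
      Subsingleton (A ⟶ (Y i)⟦n⟧) := by
    intro i hi
    induction hi using Nat.decreasingInduction with
    | self =>
      intro _ n hn hnd
      rw [← subsingleton_hom_shift_iff A (Y d) 1 (n - 1) n (by lia)]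
      exact subsingleton_of_exact (shiftPostcomp_exact₁ A htriLast (n - 1))
        (hC (d + 2) (by lia) (by lia) _ (by lia) (by lia) (by lia))
        ((subsingleton_hom_shift_iff A _ 1 (n - 1) n (by lia)).2
          (hC (d + 1) (by lia) (by lia) _ (by lia) (by lia) (by lia)))
    | of_succ i hi ih =>
      intro hi₂ n hn hnd
      rw [← subsingleton_hom_shift_iff A (Y i) 1 (n - 1) n (by lia)]
      exact subsingleton_of_exact (shiftPostcomp_exact₁ A (htri i hi₂ (by lia)) (n - 1))
        (ih (by lia) _ (by lia) (by lia))
        ((subsingleton_hom_shift_iff A _ 1 (n - 1) n (by lia)).2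
          (hC (i + 1) (by lia) (by lia) _ (by lia) (by lia) (by lia)))
  have hβ : ∀ i, 2 ≤ i → i ≤ d → Function.Surjective (shiftPostcomp A (β i) 0) := by
    intro i hi hid
    obtain rfl | ⟨i, rfl, hi'⟩ : i = 2 ∨ ∃ j, i = j + 1 ∧ 2 ≤ j := by
      rcases hi.eq_or_lt with h | h
      · exact .inl h.symm
      · exact .inr ⟨i - 1, by lia, by lia⟩
    · have := (subsingleton_hom_shift_iff A (Cobj 1) 1 0 1 (by lia)).2
        (hC 1 (by lia) (by lia) _ (by lia) (by lia) (by lia))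
      exact shiftPostcomp_surjective_of_exact (shiftPostcomp_exact₃ A htri1 0)
    · have := (subsingleton_hom_shift_iff A (Y i) 1 0 1 (by lia)).2
        (hYpos i hi' (by lia) _ (by lia) (by lia))
      exact shiftPostcomp_surjective_of_exact
        (shiftPostcomp_exact₃ A (htri i hi' (by lia)) 0)
  have hδ : ∀ i, 2 ≤ i → i ≤ d → Function.Injective (shiftPostcomp A (δ i) 0) := by
    intro i hi hid
    rw [← shiftPostcomp_shift_injective_iff A (δ i) 1 (-1) 0 (by lia)]
    rcases hid.eq_or_lt with rfl | hid
    · have := hC (i + 2) (by lia) (by lia) (-1) (by lia) (by lia) (by lia)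
      exact shiftPostcomp_injective_of_exact (shiftPostcomp_exact₁ A htriLast (-1))
    · have := hYneg (i + 1) (by lia) (by lia) (-1) (by lia) (by lia)
      exact shiftPostcomp_injective_of_exact
        (shiftPostcomp_exact₁ A (htri i hi (by lia)) (-1))
  have hid_inj : ∀ X : T, Function.Injective (shiftPostcomp A (𝟙 X) 0) :=
    fun X ↦ (shiftPostcomp_bijective A _ 0).1
  have hid_surj : ∀ X : T, Function.Surjective (shiftPostcomp A (𝟙 X) 0) :=
    fun X ↦ (shiftPostcomp_bijective A _ 0).2
  have hθ_inj : ∀ j : ℕ, j + 2 ≤ d → ∀ n : ℤ, n + j + 1 = d →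
      Function.Injective (shiftPostcomp A (θ j) n) := by
    intro j
    induction j with
    | zero =>
      intro _ n hn
      have := hC 2 (by lia) (by lia) n (by lia) (by lia) (by lia)
      rw [hθ0, shiftPostcomp_comp, AddMonoidHom.coe_comp]
      exact (shiftPostcomp_bijective A _ n).1.comp
        (shiftPostcomp_injective_of_exact (shiftPostcomp_exact₃ A htri1 n))
    | succ j ih =>
      intro hj n hn
      have := hC (j + 3) (by lia) (by lia) n (by lia) (by lia) (by lia)
      rw [hθ j (by lia)]
      exact shiftPostcomp_injective_of_recurrence A _ _ _ (by push_cast; ring) _ n _ rfl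
        (shiftPostcomp_injective_of_exact
          (shiftPostcomp_exact₃ A (htri (j + 2) (by lia) (by lia)) n))
        (ih (by lia) _ (by lia))
  have hθ_exact : ∀ j : ℕ, j + 2 ≤ d → ∀ n : ℤ, n + j + 1 = d →
      Function.Exact (shiftPostcomp A (θ j) n)
        (shiftPostcomp A ((α 1)⟦(j : ℤ) + 1⟧') n) := by
    intro j
    induction j with
    | zero =>
      intro _ n hn
      have key : ∀ (c : ℤ) (hc : 1 = c) (e : (Cobj 1)⟦(1 : ℤ)⟧ = (Cobj 1)⟦c⟧),
          Function.Exact (shiftPostcomp A (γ₂ ≫ eqToHom e) n)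
            (shiftPostcomp A ((α 1)⟦c⟧') n) := by
        rintro c rfl e
        rw [eqToHom_refl, comp_id]
        exact shiftPostcomp_exact₁ A htri1 n
      rw [hθ0]
      exact key _ (by norm_num) _
    | succ j ih =>
      intro hj n hn
      have := (subsingleton_hom_shift_iff A (Cobj (j + 3)) 1 n _ rfl).2
        (hC (j + 3) (by lia) (by lia) _ (by lia) (by lia) (by lia))
      rw [hθ j (by lia)]
      exact shiftPostcomp_exact_of_recurrence A _ _ _ _ (by push_cast; ring) _ n _ rfl
        (shiftPostcomp_surjective_of_exact
          (shiftPostcomp_exact₁ A (htri (j + 2) (by lia) (by lia)) n))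
        (ih (by lia) _ (by lia))
  obtain ⟨e, rfl⟩ : ∃ e, d = e + 2 := ⟨d - 2, by lia⟩
  replace hαlast : αlast = γ ≫ (θ e)⟦(1 : ℤ)⟧' ≫
      (shiftFunctorAdd' T ((e : ℤ) + 1) 1 ((e : ℤ) + 2) (by ring)).inv.app (Cobj 1) ≫
      eqToHom (by push_cast; rfl) := by
    rw [hαlast]
    exact congrArg (γ ≫ ·) (id_comp _)
  simp only [← exact_shiftPostcomp_zero_iff]
  refine ⟨fun i hi hid ↦ ?_, ?_, ?_⟩
  · obtain ⟨V, p, a, hp, hαi, hex⟩ : ∃ (V : T) (p : Cobj i ⟶ V) (a : V ⟶ Cobj (i + 1)),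
        Function.Surjective (shiftPostcomp A p 0) ∧ α i = p ≫ a ∧
        ∃ (W : T) (b : Cobj (i + 1) ⟶ W) (q : W ⟶ Cobj (i + 2)),
          Function.Injective (shiftPostcomp A q 0) ∧ α (i + 1) = b ≫ q ∧
          Function.Exact (shiftPostcomp A a 0) (shiftPostcomp A b 0) := by
      rcases hi.eq_or_lt with rfl | hi
      · exact ⟨Cobj 1, 𝟙 _, α 1, hid_surj _, (id_comp _).symm, Y 2, β 2, δ 2,
          hδ 2 le_rfl (by lia), hα 2 le_rfl (by lia), shiftPostcomp_exact₂ A htri1 0⟩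
      · refine ⟨_, β i, δ i, hβ i hi hid, hα i hi hid, ?_⟩
        rcases hid.eq_or_lt with rfl | hid
        · exact ⟨_, α _, 𝟙 _, hid_inj _, (comp_id _).symm, shiftPostcomp_exact₂ A htriLast 0⟩
        · exact ⟨_, β _, δ _, hδ _ (by lia) (by lia), hα _ (by lia) (by lia),
            shiftPostcomp_exact₂ A (htri i hi (by lia)) 0⟩
    obtain ⟨W, b, q, hq, hαi', hab⟩ := hex
    rw [hαi, hαi']
    exact shiftPostcomp_exact_of_surjective_injective hab hp hq
  · have hinj := (shiftPostcomp_shift_injective_iff A (θ e) 1 0 1 (by lia)).2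
      (hθ_inj e le_rfl 1 (by push_cast; ring))
    rw [hαlast, ← id_comp (α (e + 2 + 1))]
    refine shiftPostcomp_exact_of_surjective_injective (shiftPostcomp_exact₃ A htriLast 0)
      (hid_surj _) ?_
    simp only [shiftPostcomp_comp, AddMonoidHom.coe_comp]
    exact ((shiftPostcomp_bijective A _ 0).1.comp (shiftPostcomp_bijective A _ 0).1).comp hinj
  · have := (subsingleton_hom_shift_iff A (Cobj (e + 2 + 1)) 1 0 1 (by lia)).2
      (hC (e + 2 + 1) (by lia) (by lia) _ (by lia) (by lia) (by lia))
    rw [hαlast]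
    exact shiftPostcomp_exact_of_recurrence A _ _ _ _ (by push_cast; rfl) _ 0 _ (by lia)
      (shiftPostcomp_surjective_of_exact (shiftPostcomp_exact₁ A htriLast 0))
      (hθ_exact e le_rfl 1 (by push_cast; ring))
end

section
/- Let B be an abelian category, and let 0 → X_1 ⊕ I_1 → X_2 ⊕ I_2 → X_3 → 0 be a short exact sequence in B, where I_1 and I_2 are both projective and injective, the first map has matrix components f_{11} : X_1 → X_2, f_{12} : I_1 → X_2, f_{13} : X_1 → I_2, f_{14} : I_1 → I_2, and the second map has components f_{21} : X_2 → X_3, f_{22} : I_2 → X_3. Then: (1) the composite f_{21} ∘ f_{11} : X_1 → X_3 factors through an object that is both projective and injective; and (2) for every object Y and morphism g : Y → X_2, if f_{21} ∘ g factors through an object that is both projective and injective, then there exist a morphism h : Y → X_1, an object J that is both projective and injective, and morphisms s : Y → J, t : J → X_2 such that g = f_{11} ∘ h + t ∘ s. -/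
open CategoryTheory CategoryTheory.Limits

/-- Let `B` be an abelian category and
`0 → X₁ ⊞ I₁ → X₂ ⊞ I₂ → X₃ → 0` a short exact sequence, where `I₁, I₂` are both
projective and injective, the first map has components `f₁₁, f₁₂, f₁₃, f₁₄` and the second
map has components `f₂₁, f₂₂`.  Then (1) `f₂₁ ∘ f₁₁` factors through a
projective-injective object, and (2) any `g : Y ⟶ X₂` such that `g ≫ f₂₁` factors through
a projective-injective object can be written as `g = h ≫ f₁₁ + s ≫ t` with `s ≫ t`
factoring through a projective-injective object `J`. -/
theorem stable_exactness_of_biproduct_short_exact {B : Type*} [Category B] [Abelian B]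
    {X₁ I₁ X₂ I₂ X₃ : B} [Projective I₁] [Injective I₁] [Projective I₂] [Injective I₂]
    (f₁₁ : X₁ ⟶ X₂) (f₁₂ : I₁ ⟶ X₂) (f₁₃ : X₁ ⟶ I₂) (f₁₄ : I₁ ⟶ I₂)
    (f₂₁ : X₂ ⟶ X₃) (f₂₂ : I₂ ⟶ X₃)
    (w : biprod.desc (biprod.lift f₁₁ f₁₃) (biprod.lift f₁₂ f₁₄) ≫ biprod.desc f₂₁ f₂₂ = 0)
    (hse : (ShortComplex.mk
      (biprod.desc (biprod.lift f₁₁ f₁₃) (biprod.lift f₁₂ f₁₄))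
      (biprod.desc f₂₁ f₂₂) w).ShortExact) :
    (∃ (J : B), Projective J ∧ Injective J ∧
      ∃ (u : X₁ ⟶ J) (v : J ⟶ X₃), f₁₁ ≫ f₂₁ = u ≫ v) ∧
    (∀ (Y : B) (g : Y ⟶ X₂),
      (∃ (J : B), Projective J ∧ Injective J ∧
        ∃ (s : Y ⟶ J) (t : J ⟶ X₃), g ≫ f₂₁ = s ≫ t) →
      ∃ (h : Y ⟶ X₁) (J : B), Projective J ∧ Injective J ∧
        ∃ (s : Y ⟶ J) (t : J ⟶ X₂), g = h ≫ f₁₁ + s ≫ t) := by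
  have : Mono (biprod.desc (biprod.lift f₁₁ f₁₃) (biprod.lift f₁₂ f₁₄)) := hse.mono_f
  have : Epi (biprod.desc f₂₁ f₂₂) := hse.epi_g
  constructor
  · refine ⟨I₂, inferInstance, inferInstance, -f₁₃, f₂₂, ?_⟩
    have h : f₁₁ ≫ f₂₁ + f₁₃ ≫ f₂₂ = 0 := by
      simpa [biprod.lift_desc] using biprod.inl ≫= w
    rw [Preadditive.neg_comp]
    exact eq_neg_of_add_eq_zero_left h
  · rintro Y g ⟨J, _, _, s, t, hst⟩
    let t' : J ⟶ X₂ ⊞ I₂ := Projective.factorThru t (biprod.desc f₂₁ f₂₂)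
    have ht' : t' ≫ biprod.desc f₂₁ f₂₂ = t := Projective.factorThru_comp _ _
    have hzero : (g ≫ biprod.inl - s ≫ t') ≫ biprod.desc f₂₁ f₂₂ = 0 := by
      simp [Preadditive.sub_comp, ht', hst]
    let k : Y ⟶ X₁ ⊞ I₁ := hse.exact.lift _ hzero
    have hk : k ≫ biprod.desc (biprod.lift f₁₁ f₁₃) (biprod.lift f₁₂ f₁₄) =
        g ≫ biprod.inl - s ≫ t' := hse.exact.lift_f _ hzero
    have hfst : biprod.desc (biprod.lift f₁₁ f₁₃) (biprod.lift f₁₂ f₁₄) ≫ biprod.fst =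
        biprod.fst ≫ f₁₁ + biprod.snd ≫ f₁₂ := by
      ext <;> simp
    have hg : k ≫ biprod.fst ≫ f₁₁ + k ≫ biprod.snd ≫ f₁₂ = g - s ≫ t' ≫ biprod.fst := by
      rw [← Preadditive.comp_add, ← hfst, ← Category.assoc, hk]
      simp [Preadditive.sub_comp]
    refine ⟨k ≫ biprod.fst, I₁ ⊞ J, inferInstance, inferInstance,
      biprod.lift (k ≫ biprod.snd) s, biprod.desc f₁₂ (t' ≫ biprod.fst), ?_⟩
    rw [biprod.lift_desc, ← add_assoc, Category.assoc, Category.assoc, hg, sub_add_cancel]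
end

section
/- Let B be an abelian category. Suppose given short exact sequences 0 → X_1 →^{i_1} I_1 →^{p_1} S_1 → 0, 0 → X_2 →^{i_2} I_2 →^{p_2} S_2 → 0, and 0 → X_2 →^{f_2} X_3 →^{f_3} S_1 → 0 with I_1 and I_2 injective, together with morphisms f_1 : X_1 → X_2, a_1 : I_1 → X_3, g : I_1 → I_2, and s : S_1 → S_2 satisfying f_2 ∘ f_1 = a_1 ∘ i_1, f_3 ∘ a_1 = p_1, g ∘ i_1 = i_2 ∘ f_1, and s ∘ p_1 = p_2 ∘ g. Then there exists a morphism a_2 : X_3 → I_2 such that a_2 ∘ f_2 = i_2, a_2 ∘ a_1 = g, and p_2 ∘ a_2 = s ∘ f_3; moreover the following three sequences are short exact: 0 → X_1 →^{(f_1, i_1)^T} X_2 ⊕ I_1 →^{(f_2, −a_1)} X_3 → 0; 0 → X_2 ⊕ I_1 →^{((f_2, −a_1),(0, 1))} X_3 ⊕ I_1 →^{(f_3, p_1)} S_1 → 0; and 0 → X_3 →^{(f_3, a_2)^T} S_1 ⊕ I_2 →^{(s, −p_2)} S_2 → 0. -/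
open CategoryTheory CategoryTheory.Limits

namespace CategoryTheory.ShortComplex.ShortExact

variable {C : Type*} [Category C] [Abelian C]

/-- A morphism of short exact sequences that is the identity on the right-hand objects
yields a short exact sequence from its left-hand square. -/
lemma lift_desc_of_right_eq {X₁ X₂ Y₁ Y₂ Z : C} {i₁ : X₁ ⟶ Y₁} {p₁ : Y₁ ⟶ Z}
    {w₁ : i₁ ≫ p₁ = 0} (h₁ : (ShortComplex.mk i₁ p₁ w₁).ShortExact)
    {i₂ : X₂ ⟶ Y₂} {p₂ : Y₂ ⟶ Z} {w₂ : i₂ ≫ p₂ = 0}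
    (h₂ : (ShortComplex.mk i₂ p₂ w₂).ShortExact) {f : X₁ ⟶ X₂} {a : Y₁ ⟶ Y₂}
    (hi : f ≫ i₂ = i₁ ≫ a) (hp : a ≫ p₂ = p₁)
    (w : biprod.lift f i₁ ≫ biprod.desc i₂ (-a) = 0) :
    (ShortComplex.mk (biprod.lift f i₁) (biprod.desc i₂ (-a)) w).ShortExact := by
  have : Mono i₁ := h₁.mono_f
  have : Epi p₁ := h₁.epi_g
  have : Mono i₂ := h₂.mono_f
  refine { exact := ?_, mono_f := ?_, epi_g := ?_ }
  · rw [exact_iff_exact_up_to_refinements]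
    intro A z hz
    have hz' : (z ≫ biprod.fst) ≫ i₂ = (z ≫ biprod.snd) ≫ a := by
      simpa [biprod.desc_eq, add_neg_eq_zero] using hz
    obtain ⟨A', π, _, x, hx⟩ := h₁.exact.exact_up_to_refinements (z ≫ biprod.snd) (by
      have := hz' =≫ p₂
      simpa [w₂, hp] using this.symm)
    dsimp at x hx
    refine ⟨A', π, inferInstance, x, ?_⟩
    ext
    · rw [← cancel_mono i₂]
      have hx' := hx =≫ a
      simp only [Category.assoc] at hz' hx'
      simp [hi, ← hx', hz']
    · simpa using hx
  · exact mono_of_mono_fac (biprod.lift_snd f i₁)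
  · rw [epi_iff_surjective_up_to_refinements]
    intro A y
    obtain ⟨A', π, _, u, hu⟩ := surjective_up_to_refinements_of_epi p₁ (y ≫ p₂)
    obtain ⟨A'', π', _, v, hv⟩ := h₂.exact.exact_up_to_refinements (π ≫ y - u ≫ a) (by
      simp [hp, hu])
    dsimp at v hv
    refine ⟨A'', π' ≫ π, epi_comp _ _, biprod.lift v (-(π' ≫ u)), ?_⟩
    simp [← hv]

/-- A morphism of short exact sequences that is the identity on the left-hand objects
yields a short exact sequence from its right-hand square. -/
lemma lift_desc_of_left_eq {X Y₁ Y₂ Z₁ Z₂ : C} {i₁ : X ⟶ Y₁} {p₁ : Y₁ ⟶ Z₁}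
    {w₁ : i₁ ≫ p₁ = 0} (h₁ : (ShortComplex.mk i₁ p₁ w₁).ShortExact)
    {i₂ : X ⟶ Y₂} {p₂ : Y₂ ⟶ Z₂} {w₂ : i₂ ≫ p₂ = 0}
    (h₂ : (ShortComplex.mk i₂ p₂ w₂).ShortExact) {a : Y₁ ⟶ Y₂} {s : Z₁ ⟶ Z₂}
    (hi : i₁ ≫ a = i₂) (hp : a ≫ p₂ = p₁ ≫ s)
    (w : biprod.lift p₁ a ≫ biprod.desc s (-p₂) = 0) :
    (ShortComplex.mk (biprod.lift p₁ a) (biprod.desc s (-p₂)) w).ShortExact := by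
  have : Epi p₁ := h₁.epi_g
  have : Mono i₂ := h₂.mono_f
  have : Epi p₂ := h₂.epi_g
  refine { exact := ?_, mono_f := ?_, epi_g := ?_ }
  · rw [exact_iff_exact_up_to_refinements]
    intro A z hz
    have hz' : (z ≫ biprod.fst) ≫ s = (z ≫ biprod.snd) ≫ p₂ := by
      simpa [biprod.desc_eq, add_neg_eq_zero] using hz
    obtain ⟨A', π, _, y, hy⟩ := surjective_up_to_refinements_of_epi p₁ (z ≫ biprod.fst)
    obtain ⟨A'', π', _, x, hx⟩ := h₂.exact.exact_up_to_refinements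
      (π ≫ z ≫ biprod.snd - y ≫ a) (by
        have hy' := hy =≫ s
        simp only [Category.assoc] at hz' hy'
        simp [hp, ← hy', hz'])
    dsimp at x hx
    refine ⟨A'', π' ≫ π, epi_comp _ _, π' ≫ y + x ≫ i₁, ?_⟩
    ext
    · simp [w₁, hy]
    · simp [hi, ← hx]
  · refine Preadditive.mono_of_cancel_zero _ fun y hy ↦ ?_
    have hy₁ : y ≫ p₁ = 0 := by simpa using hy =≫ biprod.fst
    have hy₂ : y ≫ a = 0 := by simpa using hy =≫ biprod.snd
    obtain ⟨A', π, _, x, hx⟩ := h₁.exact.exact_up_to_refinements y hy₁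
    dsimp at x hx
    have hx₀ : x = 0 := by
      rw [← cancel_mono i₂, ← hi, ← Category.assoc, ← hx]
      simp [hy₂]
    rw [← cancel_epi π, hx, hx₀, zero_comp, comp_zero]
  · have : Epi (-p₂) := inferInstance
    exact epi_of_epi_fac (biprod.inr_desc s (-p₂))

/-- Adding a summand `W` to the first two terms of a short exact sequence, twisted by
a morphism from `W` to the middle term. -/
lemma biprod_of_hom {X Y Z W : C} {f : X ⟶ Y} {p : Y ⟶ Z} {w : f ≫ p = 0}
    (h : (ShortComplex.mk f p w).ShortExact) {a : W ⟶ Y} {q : W ⟶ Z} (hq : a ≫ p = q)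
    (w' : biprod.desc (biprod.lift f (0 : X ⟶ W)) (biprod.lift (-a) (𝟙 W)) ≫
      biprod.desc p q = 0) :
    (ShortComplex.mk (biprod.desc (biprod.lift f (0 : X ⟶ W)) (biprod.lift (-a) (𝟙 W)))
      (biprod.desc p q) w').ShortExact := by
  have : Mono f := h.mono_f
  have : Epi p := h.epi_g
  refine { exact := ?_, mono_f := ?_, epi_g := ?_ }
  · rw [exact_iff_exact_up_to_refinements]
    intro A z hz
    have hz' : z ≫ biprod.fst ≫ p + z ≫ biprod.snd ≫ q = 0 := by
      simpa [biprod.desc_eq] using hz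
    obtain ⟨A', π, _, x, hx⟩ := h.exact.exact_up_to_refinements
      (z ≫ biprod.fst + z ≫ biprod.snd ≫ a) (by simpa [hq] using hz')
    dsimp at x hx
    refine ⟨A', π, inferInstance, biprod.lift x (π ≫ z ≫ biprod.snd), ?_⟩
    ext
    · simp [← hx]
    · simp
  · refine Preadditive.mono_of_cancel_zero _ fun z hz ↦ ?_
    have hz₂ : z ≫ biprod.snd = 0 := by
      simpa [biprod.desc_eq] using hz =≫ biprod.snd
    have hz₁ : z ≫ biprod.fst = 0 := by
      rw [← cancel_mono f]
      simpa [biprod.desc_eq, reassoc_of% hz₂] using hz =≫ biprod.fst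
    ext <;> simp [hz₁, hz₂]
  · exact epi_of_epi_fac (biprod.inl_desc p q)

end CategoryTheory.ShortComplex.ShortExact

/-- Let `B` be an abelian category with short exact sequences
`0 → X₁ →i₁ I₁ →p₁ S₁ → 0`, `0 → X₂ →i₂ I₂ →p₂ S₂ → 0` and `0 → X₂ →f₂ X₃ →f₃ S₁ → 0`
(`I₁, I₂` injective), and morphisms `f₁ : X₁ ⟶ X₂`, `a₁ : I₁ ⟶ X₃`, `g : I₁ ⟶ I₂`,
`s : S₁ ⟶ S₂` with `f₂ ∘ f₁ = a₁ ∘ i₁`, `f₃ ∘ a₁ = p₁`, `g ∘ i₁ = i₂ ∘ f₁` and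
`s ∘ p₁ = p₂ ∘ g`.  Then there exists `a₂ : X₃ ⟶ I₂` with `a₂ ∘ f₂ = i₂`, `a₂ ∘ a₁ = g`
and `p₂ ∘ a₂ = s ∘ f₃`, and moreover the three sequences
`0 → X₁ → X₂ ⊞ I₁ → X₃ → 0`, `0 → X₂ ⊞ I₁ → X₃ ⊞ I₁ → S₁ → 0` and
`0 → X₃ → S₁ ⊞ I₂ → S₂ → 0` are short exact. -/
theorem three_short_exact_sequences {B : Type*} [Category B] [Abelian B]
    {X₁ X₂ X₃ I₁ I₂ S₁ S₂ : B} [Injective I₁] [Injective I₂]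
    (i₁ : X₁ ⟶ I₁) (p₁ : I₁ ⟶ S₁) (w₁ : i₁ ≫ p₁ = 0)
    (h₁ : (ShortComplex.mk i₁ p₁ w₁).ShortExact)
    (i₂ : X₂ ⟶ I₂) (p₂ : I₂ ⟶ S₂) (w₂ : i₂ ≫ p₂ = 0)
    (h₂ : (ShortComplex.mk i₂ p₂ w₂).ShortExact)
    (f₂ : X₂ ⟶ X₃) (f₃ : X₃ ⟶ S₁) (w₃ : f₂ ≫ f₃ = 0)
    (h₃ : (ShortComplex.mk f₂ f₃ w₃).ShortExact)
    (f₁ : X₁ ⟶ X₂) (a₁ : I₁ ⟶ X₃) (g : I₁ ⟶ I₂) (s : S₁ ⟶ S₂)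
    (hc₁ : f₁ ≫ f₂ = i₁ ≫ a₁) (hc₂ : a₁ ≫ f₃ = p₁)
    (hc₃ : i₁ ≫ g = f₁ ≫ i₂) (hc₄ : p₁ ≫ s = g ≫ p₂) :
    ∃ a₂ : X₃ ⟶ I₂,
      f₂ ≫ a₂ = i₂ ∧ a₁ ≫ a₂ = g ∧ a₂ ≫ p₂ = f₃ ≫ s ∧
      (∃ w : biprod.lift f₁ i₁ ≫ biprod.desc f₂ (-a₁) = 0,
        (ShortComplex.mk (biprod.lift f₁ i₁) (biprod.desc f₂ (-a₁)) w).ShortExact) ∧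
      (∃ w : biprod.desc (biprod.lift f₂ (0 : X₂ ⟶ I₁)) (biprod.lift (-a₁) (𝟙 I₁)) ≫
          biprod.desc f₃ p₁ = 0,
        (ShortComplex.mk
          (biprod.desc (biprod.lift f₂ (0 : X₂ ⟶ I₁)) (biprod.lift (-a₁) (𝟙 I₁)))
          (biprod.desc f₃ p₁) w).ShortExact) ∧
      (∃ w : biprod.lift f₃ a₂ ≫ biprod.desc s (-p₂) = 0,
        (ShortComplex.mk (biprod.lift f₃ a₂) (biprod.desc s (-p₂)) w).ShortExact) := by
  have w : biprod.lift f₁ i₁ ≫ biprod.desc f₂ (-a₁) = 0 := by simp [hc₁]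
  have h := h₁.lift_desc_of_right_eq h₃ hc₁ hc₂ w
  have : Epi (biprod.desc f₂ (-a₁)) := h.epi_g
  obtain ⟨a₂, ha₂⟩ : ∃ a₂ : X₃ ⟶ I₂, biprod.desc f₂ (-a₁) ≫ a₂ = biprod.desc i₂ (-g) :=
    ⟨h.exact.desc (biprod.desc i₂ (-g)) (by simp [hc₃]), h.exact.g_desc _ _⟩
  have hf₂ : f₂ ≫ a₂ = i₂ := by simpa using biprod.inl ≫= ha₂
  have ha₁ : a₁ ≫ a₂ = g := by simpa using biprod.inr ≫= ha₂
  have hp₂ : a₂ ≫ p₂ = f₃ ≫ s := by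
    rw [← cancel_epi (biprod.desc f₂ (-a₁))]
    ext
    · simp [reassoc_of% hf₂, reassoc_of% w₃, w₂]
    · simp [reassoc_of% ha₁, reassoc_of% hc₂, hc₄]
  have w' : biprod.desc (biprod.lift f₂ (0 : X₂ ⟶ I₁)) (biprod.lift (-a₁) (𝟙 I₁)) ≫
      biprod.desc f₃ p₁ = 0 := by
    ext <;> simp [w₃, hc₂]
  have w'' : biprod.lift f₃ a₂ ≫ biprod.desc s (-p₂) = 0 := by simp [hp₂]
  exact ⟨a₂, hf₂, ha₁, hp₂, ⟨w, h⟩, ⟨w', h₃.biprod_of_hom hc₂ w'⟩,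
    ⟨w'', h₃.lift_desc_of_left_eq h₂ hf₂ hp₂ w''⟩⟩
end

section
/- Let R be a commutative local ring whose maximal ideal m is principal, generated by an element p, and satisfies m² = 0. Then R is self-injective, i.e., R is injective as a module over itself. -/
open IsLocalRing

/-- A linear map out of an ideal `I` which agrees with multiplication by `s` on an element of `I`
generating `I` extends to a linear map on the whole ring. -/
lemma exists_extension_of_apply_eq_mul {R : Type*} [CommRing R] {I : Ideal R} (g : I →ₗ[R] R)
    {y s : R} (hy : y ∈ I) (hI : ∀ x ∈ I, y ∣ x) (hg : g ⟨y, hy⟩ = y * s) :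
    ∃ g' : R →ₗ[R] R, ∀ (x : R) (mem : x ∈ I), g' x = g ⟨x, mem⟩ := by
  refine ⟨LinearMap.toSpanSingleton R R s, fun x hx ↦ ?_⟩
  obtain ⟨c, rfl⟩ := hI x hx
  have hc : (⟨y * c, hx⟩ : I) = c • ⟨y, hy⟩ := Subtype.ext (mul_comm y c)
  rw [hc, map_smul, hg, LinearMap.toSpanSingleton_apply, smul_eq_mul, smul_eq_mul]
  ring

/-- Let `R` be a commutative local ring whose maximal ideal `m` is principal, generated by
`p`, with `m ^ 2 = 0`.  Then `R` is self-injective: `R` is injective as a module over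
itself. -/
theorem self_injective_of_local_ring_with_square_zero_principal_maximal_ideal
    (R : Type*) [CommRing R] [IsLocalRing R] (p : R)
    (hp : maximalIdeal R = Ideal.span {p})
    (hm2 : (maximalIdeal R) ^ 2 = ⊥) :
    Module.Injective R R := by
  have hmem (x : R) : x ∈ maximalIdeal R ↔ p ∣ x := by rw [hp, Ideal.mem_span_singleton]
  have hmul {x y : R} (hx : x ∈ maximalIdeal R) (hy : y ∈ maximalIdeal R) : x * y = 0 := by
    have h := Ideal.mul_mem_mul hx hy
    rwa [← pow_two, hm2, Ideal.mem_bot] at h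
  have hpm : p ∈ maximalIdeal R := (hmem p).2 dvd_rfl
  refine Module.Baer.injective fun I g ↦ ?_
  by_cases htop : I = ⊤
  · exact exists_extension_of_apply_eq_mul g (y := 1) (htop ▸ Submodule.mem_top)
      (fun x _ ↦ one_dvd x) (one_mul _).symm
  have hI : ∀ x ∈ I, p ∣ x := fun x hx ↦ (hmem x).1 (le_maximalIdeal htop hx)
  by_cases hbot : I = ⊥
  · refine ⟨0, fun x hx ↦ ?_⟩
    obtain rfl : x = 0 := by simpa [hbot] using hx
    exact (map_zero g).symm
  obtain ⟨x, hx, hx0⟩ := Submodule.exists_mem_ne_zero_of_ne_bot hbot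
  obtain ⟨a, rfl⟩ := hI x hx
  have ha : IsUnit a := notMem_maximalIdeal.1 fun h ↦ hx0 (hmul hpm h)
  have hpI : p ∈ I := (Ideal.mul_unit_mem_iff_mem I ha).1 hx
  have hpg : p * g ⟨p, hpI⟩ = 0 := by
    have hpp : p • (⟨p, hpI⟩ : I) = 0 := Subtype.ext (hmul hpm hpm)
    rw [← smul_eq_mul, ← map_smul, hpp, map_zero]
  have hgm : g ⟨p, hpI⟩ ∈ maximalIdeal R := by
    by_contra h
    have hp0 : p = 0 := (notMem_maximalIdeal.1 h).mul_left_eq_zero.1 hpg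
    exact hx0 (by rw [hp0, zero_mul])
  obtain ⟨b, hb⟩ := (hmem _).1 hgm
  exact exists_extension_of_apply_eq_mul g hpI hI hb
end

section
/- Let R be a commutative local ring whose maximal ideal m is principal, generated by an element p, and satisfies m² = 0. Then every finitely generated R-module M is isomorphic to a finite direct sum of copies of R and of m; that is, there exist natural numbers a and b with M ≅ R^a ⊕ m^b as R-modules (where m is regarded as an R-module). -/
open IsLocalRing

section

variable {R M : Type*} [CommRing R] [AddCommGroup M] [Module R M]

/-- The classes in `M ⧸ I • ⊤` that have a representative annihilated by `p`, as a submodule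
over `R ⧸ I`. -/
def residualTorsion (I : Ideal R) (p : R) (M : Type*) [AddCommGroup M] [Module R M] :
    Submodule (R ⧸ I) (M ⧸ (I • ⊤ : Submodule R M)) where
  carrier := {v | ∃ x : M, Submodule.Quotient.mk x = v ∧ p • x = 0}
  add_mem' := by
    rintro _ _ ⟨x, rfl, hx⟩ ⟨y, rfl, hy⟩
    exact ⟨x + y, rfl, by rw [smul_add, hx, hy, add_zero]⟩
  zero_mem' := ⟨0, rfl, smul_zero p⟩
  smul_mem' := by
    intro c _ ⟨x, hxv, hx⟩
    subst hxv
    obtain ⟨r, rfl⟩ := Ideal.Quotient.mk_surjective c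
    exact ⟨r • x, rfl, by rw [smul_comm, hx, smul_zero]⟩

theorem smul_eq_zero_of_mem_smul_top {I : Ideal R} {p : R} (hp : p ∈ I) (hI : I ^ 2 = ⊥)
    {x : M} (hx : x ∈ (I • ⊤ : Submodule R M)) : p • x = 0 := by
  have h : p • x ∈ I • (I • ⊤ : Submodule R M) := Submodule.smul_mem_smul hp hx
  rwa [← Submodule.mul_smul, ← pow_two, hI, Submodule.bot_smul, Submodule.mem_bot] at h

theorem mk_mem_residualTorsion_iff {I : Ideal R} {p : R} (hp : p ∈ I) (hI : I ^ 2 = ⊥) {x : M} :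
    Submodule.Quotient.mk x ∈ residualTorsion I p M ↔ p • x = 0 := by
  refine ⟨?_, fun h => ⟨x, rfl, h⟩⟩
  rintro ⟨y, hyx, hy⟩
  have h := smul_eq_zero_of_mem_smul_top hp hI ((Submodule.Quotient.eq _).1 hyx)
  rw [smul_sub, hy, zero_sub, neg_eq_zero] at h
  exact h

/-- A basis of `M ⧸ m • ⊤` lifts to generators of `M`. -/
theorem span_range_eq_top_of_basis_quotient [IsLocalRing R] [Module.Finite R M]
    {ι : Type*} (b : Module.Basis ι (R ⧸ maximalIdeal R)
      (M ⧸ (maximalIdeal R • ⊤ : Submodule R M)))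
    (z : ι → M) (hz : ∀ i, Submodule.Quotient.mk (z i) = b i) :
    Submodule.span R (Set.range z) = ⊤ := by
  rw [eq_top_iff]
  refine Submodule.le_of_le_smul_of_le_jacobson_bot Module.Finite.fg_top
    (maximalIdeal_le_jacobson _) ?_
  intro x _
  have hmap : (Submodule.span R (Set.range z)).map (Submodule.mkQ (maximalIdeal R • ⊤)) = ⊤ := by
    rw [Submodule.map_span, ← Set.range_comp,
      show (Submodule.mkQ (maximalIdeal R • (⊤ : Submodule R M))) ∘ z = b from funext hz,
      ← Submodule.restrictScalars_span R (R ⧸ maximalIdeal R) Ideal.Quotient.mk_surjective,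
      b.span_eq, Submodule.restrictScalars_top]
  obtain ⟨y, hy, hyx⟩ : Submodule.mkQ (maximalIdeal R • ⊤) x ∈
    (Submodule.span R (Set.range z)).map (Submodule.mkQ (maximalIdeal R • ⊤)) := hmap ▸ trivial
  rw [← add_sub_cancel y x]
  exact Submodule.add_mem_sup hy ((Submodule.Quotient.eq _).1 hyx.symm)

/-- Generators `x`, `y` of `M` that form a basis modulo `m`, such that the `y j` are annihilated
by `p` and the `p • x i` are linearly independent over `R ⧸ m`. -/
theorem exists_generators_adapted_to_torsion [IsLocalRing R] [Module.Finite R M] {p : R}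
    (hp : p ∈ maximalIdeal R) (hm2 : maximalIdeal R ^ 2 = ⊥) :
    ∃ (a b : ℕ) (x : Fin a → M) (y : Fin b → M),
      (∀ z : M, ∃ (r : Fin a → R) (s : Fin b → R), ∑ i, r i • x i + ∑ j, s j • y j = z) ∧
      (∀ (r : Fin a → R) (s : Fin b → R), ∑ i, r i • x i + ∑ j, s j • y j = 0 →
        (∀ i, r i ∈ maximalIdeal R) ∧ ∀ j, s j ∈ maximalIdeal R) ∧
      (∀ j, p • y j = 0) ∧
      ∀ r : Fin a → R, p • ∑ i, r i • x i = 0 → ∀ i, r i ∈ maximalIdeal R := by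
  let : Field (R ⧸ maximalIdeal R) := Ideal.Quotient.field _
  have : Module.Finite (R ⧸ maximalIdeal R) (M ⧸ (maximalIdeal R • ⊤ : Submodule R M)) :=
    Module.Finite.of_restrictScalars_finite R _ _
  obtain ⟨C, hC⟩ := exists_isCompl (residualTorsion (maximalIdeal R) p M)
  let bC := Module.finBasis (R ⧸ maximalIdeal R) C
  let bK := Module.finBasis (R ⧸ maximalIdeal R) (residualTorsion (maximalIdeal R) p M)
  let B := (bC.prod bK).map (Submodule.prodEquivOfIsCompl _ _ hC.symm)
  choose x hx using fun i => Submodule.Quotient.mk_surjective _ (bC i).1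
  choose y hy using fun j => Submodule.Quotient.mk_surjective _ (bK j).1
  have hB : ∀ i, Submodule.Quotient.mk (Sum.elim x y i) = B i := by
    rintro (i | j) <;> simp [B, hx, hy]
  have hspan := span_range_eq_top_of_basis_quotient B _ hB
  have hmk : ∀ {n : ℕ} (r : Fin n → R) (u : Fin n → M),
      (Submodule.Quotient.mk (∑ i, r i • u i) : M ⧸ (maximalIdeal R • ⊤ : Submodule R M)) =
      ∑ i, Ideal.Quotient.mk (maximalIdeal R) (r i) • Submodule.Quotient.mk (u i) := by
    intro n r u
    rw [← Submodule.mkQ_apply, map_sum]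
    rfl
  refine ⟨_, _, x, y, fun z => ?_, fun r s h => ?_, fun j => ?_, fun r h i => ?_⟩
  · have hz : z ∈ Submodule.span R (Set.range (Sum.elim x y)) := by
      rw [hspan]
      trivial
    obtain ⟨c, hc⟩ := (Submodule.mem_span_range_iff_exists_fun R).1 hz
    exact ⟨fun i => c (.inl i), fun j => c (.inr j), by simpa using hc⟩
  · have h' := congrArg (Submodule.Quotient.mk (p := (maximalIdeal R • ⊤ : Submodule R M))) h
    rw [Submodule.Quotient.mk_add, hmk, hmk] at h'
    have hli := Fintype.linearIndependent_iff.1 B.linearIndependent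
      (fun i => Ideal.Quotient.mk _ (Sum.elim r s i)) (by
        simp only [← hB]
        simpa using h')
    exact ⟨fun i => Ideal.Quotient.eq_zero_iff_mem.1 (hli (.inl i)),
      fun j => Ideal.Quotient.eq_zero_iff_mem.1 (hli (.inr j))⟩
  · rw [← mk_mem_residualTorsion_iff hp hm2, hy]
    exact (bK j).2
  · rw [← mk_mem_residualTorsion_iff hp hm2, hmk] at h
    simp only [hx] at h
    have h0 := (Submodule.disjoint_def.1 hC.disjoint) _ h
      (Submodule.sum_mem _ fun i _ => C.smul_mem _ (bC i).2)
    have hli := Fintype.linearIndependent_iff.1 bC.linearIndependent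
      (fun i => Ideal.Quotient.mk _ (r i)) (by
        ext
        simpa using h0)
    exact Ideal.Quotient.eq_zero_iff_mem.1 (hli i)

end

/-- Let `R` be a commutative local ring whose maximal ideal `m` is principal, generated by
`p`, with `m ^ 2 = 0`.  Then every finitely generated `R`-module `M` is isomorphic to a
finite direct sum of copies of `R` and of `m`: there are `a b : ℕ` with
`M ≃ₗ[R] R ^ a × m ^ b`. -/
theorem fg_module_decomposition_of_local_ring_with_square_zero_principal_maximal_ideal
    (R : Type*) [CommRing R] [IsLocalRing R] (p : R)
    (hp : maximalIdeal R = Ideal.span {p})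
    (hm2 : (maximalIdeal R) ^ 2 = ⊥)
    (M : Type*) [AddCommGroup M] [Module R M] [Module.Finite R M] :
    ∃ a b : ℕ, Nonempty (M ≃ₗ[R] ((Fin a → R) × (Fin b → (maximalIdeal R)))) := by
  have hpm : p ∈ maximalIdeal R := hp ▸ Ideal.mem_span_singleton_self p
  by_cases hp0 : p = 0
  · have hfield : IsField R := IsLocalRing.isField_iff_maximalIdeal_eq.2 (by simp [hp, hp0])
    let := hfield.toField
    exact ⟨_, 0, ⟨(Module.finBasis R M).equivFun.trans (LinearEquiv.prodUnique).symm⟩⟩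
  have hmul : ∀ r ∈ maximalIdeal R, r * p = 0 := fun r hr => by
    have h := Ideal.mul_mem_mul hr hpm
    rwa [← pow_two, hm2, Ideal.mem_bot] at h
  have hmem : ∀ r, r * p = 0 → r ∈ maximalIdeal R := fun r hr => by
    rw [mem_maximalIdeal, mem_nonunits_iff]
    intro hu
    exact hp0 ((hu.mul_right_eq_zero).1 hr)
  obtain ⟨a, b, x, y, hgen, hrel, hy, hx⟩ :=
    exists_generators_adapted_to_torsion (M := M) hpm hm2
  refine ⟨a, b, ?_⟩
  let f : ((Fin a → R) × (Fin b → R)) →ₗ[R] M :=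
    (Fintype.linearCombination R x).coprod (Fintype.linearCombination R y)
  have hf : ∀ r s, f (r, s) = ∑ i, r i • x i + ∑ j, s j • y j := fun r s => by
    simp [f, Fintype.linearCombination_apply]
  let g : ((Fin a → R) × (Fin b → R)) →ₗ[R] ((Fin a → R) × (Fin b → maximalIdeal R)) :=
    LinearMap.prodMap LinearMap.id
      (LinearMap.pi fun j => (LinearMap.toSpanSingleton R _ ⟨p, hpm⟩).comp (LinearMap.proj j))
  have hfs : Function.Surjective f := fun z => by
    obtain ⟨r, s, h⟩ := hgen z
    exact ⟨(r, s), (hf r s).trans h⟩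
  have hgs : Function.Surjective g := by
    rintro ⟨r, t⟩
    have ht : ∀ j, ∃ s, s * p = t j := fun j =>
      Ideal.mem_span_singleton'.1 (hp ▸ (t j).2)
    choose s hs using ht
    exact ⟨(r, s), Prod.ext rfl (funext fun j => Subtype.ext (hs j))⟩
  have hg : ∀ r s, g (r, s) = 0 ↔ r = 0 ∧ ∀ j, s j * p = 0 := fun r s => by
    simp [g, Prod.ext_iff, funext_iff, Subtype.ext_iff]
  have hker : LinearMap.ker f = LinearMap.ker g := by
    ext ⟨r, s⟩
    rw [LinearMap.mem_ker, LinearMap.mem_ker, hf, hg]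
    have hsy : (∀ j, s j ∈ maximalIdeal R) → ∑ j, s j • y j = 0 := fun hs =>
      Finset.sum_eq_zero fun j _ => by
        obtain ⟨c, hc⟩ := Ideal.mem_span_singleton'.1 (hp ▸ hs j)
        rw [← hc, mul_smul, hy, smul_zero]
    constructor
    · intro h
      obtain ⟨hr, hs⟩ := hrel r s h
      refine ⟨?_, fun j => hmul _ (hs j)⟩
      choose c hc using fun i => Ideal.mem_span_singleton'.1 (hp ▸ hr i)
      rw [hsy hs, add_zero] at h
      have hcm := hx c (by
        rw [Finset.smul_sum, ← h]
        exact Finset.sum_congr rfl fun i _ => by rw [← hc, mul_comm, mul_smul])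
      exact funext fun i => (hc i).symm.trans (hmul _ (hcm i))
    · rintro ⟨rfl, hs⟩
      simp [hsy fun j => hmem _ (hs j)]
  exact ⟨(f.quotKerEquivOfSurjective hfs).symm.trans
    ((Submodule.quotEquivOfEq _ _ hker).trans (g.quotKerEquivOfSurjective hgs))⟩
end

section
/- Let R be a commutative local ring whose maximal ideal m is principal, generated by an element p ≠ 0, and satisfies m² = 0, let n ≥ 3, and let u, v be units of R. For a unit u, let R(u)• denote the n-periodic complex with R in every degree i ∈ ℤ and with differential d_i : R → R equal to multiplication by up when i ≡ 1 (mod n) and multiplication by p otherwise. Then R(u)• and R(v)• are n-periodically homotopy equivalent if and only if up = vp. Here an n-periodic chain map w : R(u)• → R(v)• is a family (w_i)_{i∈ℤ} of elements of R with w_{i+n} = w_i and d^{R(v)}_i w_i = w_{i+1} d^{R(u)}_i for all i; two n-periodic chain maps φ, ψ between the same complexes are n-periodically homotopic if there is a family (h_i)_{i∈ℤ} in R with h_{i+n} = h_i and φ_i − ψ_i = h_i d_i + d_{i−1} h_{i−1} for all i; and R(u)• and R(v)• are n-periodically homotopy equivalent if there are n-periodic chain maps w : R(u)• → R(v)• and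 w' : R(v)• → R(u)• such that w'w and ww' are each n-periodically homotopic to the identity chain map. -/
open IsLocalRing

/-- The differential of the `n`-periodic complex `R(c)•`: every object is `R`, and the
differential in degree `i` is multiplication by `c * p` if `i ≡ 1 (mod n)` and
multiplication by `p` otherwise.  Since every object is `R`, we record the differential as
the element of `R` by which one multiplies. -/
def periodicDiff (R : Type*) [CommRing R] (n : ℕ) (c p : R) : ℤ → R :=
  fun i => if i % (n : ℤ) = 1 then c * p else p

/-- An `n`-periodic chain map between two `n`-periodic complexes with all objects `R`
whose differentials are multiplication by `du i` resp. `dv i`: a family `(w i)` of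
elements of `R` (acting by multiplication) with `w (i + n) = w i` and
`dv i * w i = w (i + 1) * du i` for all `i`. -/
def IsPeriodicChainMap (R : Type*) [CommRing R] (n : ℕ) (du dv : ℤ → R)
    (w : ℤ → R) : Prop :=
  (∀ i : ℤ, w (i + n) = w i) ∧ ∀ i : ℤ, dv i * w i = w (i + 1) * du i

/-- Two `n`-periodic chain maps `φ, ψ` between the complexes with differentials `du`
(source) and `dv` (target) are `n`-periodically homotopic if there is a family `(h i)` in
`R` with `h (i + n) = h i` and `φ i - ψ i = h i * du i + dv (i - 1) * h (i - 1)`. -/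
def IsPeriodicHomotopic (R : Type*) [CommRing R] (n : ℕ) (du dv : ℤ → R)
    (φ ψ : ℤ → R) : Prop :=
  ∃ h : ℤ → R, (∀ i : ℤ, h (i + n) = h i) ∧
    ∀ i : ℤ, φ i - ψ i = h i * du i + dv (i - 1) * h (i - 1)

theorem periodicDiff_one (R : Type*) [CommRing R] {n : ℕ} (hn : 2 ≤ n) (c p : R) :
    periodicDiff R n c p 1 = c * p :=
  if_pos (Int.emod_eq_of_lt (by omega) (by omega))

theorem periodicDiff_of_two_le_of_le (R : Type*) [CommRing R] {n : ℕ} (c p : R) {i : ℤ}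
    (h2 : 2 ≤ i) (hi : i ≤ n) : periodicDiff R n c p i = p := by
  refine if_neg fun h => ?_
  rcases hi.lt_or_eq with hlt | rfl
  · rw [Int.emod_eq_of_lt (by omega) hlt] at h
    omega
  · simp at h

/-- Every differential is a multiple of `p`. -/
theorem dvd_periodicDiff (R : Type*) [CommRing R] (n : ℕ) (c p : R) (i : ℤ) :
    p ∣ periodicDiff R n c p i := by
  unfold periodicDiff
  split_ifs
  · exact dvd_mul_left p c
  · exact dvd_rfl

/-- The differentials in degree `1` of source and target agree after multiplication by the
degree `1` component of a periodic chain map. -/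
theorem IsPeriodicChainMap.mul_apply_one {R : Type*} [CommRing R] {n : ℕ} (hn : 2 ≤ n)
    {a b p : R} {w : ℤ → R}
    (hw : IsPeriodicChainMap R n (periodicDiff R n a p) (periodicDiff R n b p) w) :
    b * p * w 1 = a * p * w 1 := by
  obtain ⟨hper, hcomm⟩ := hw
  have key : ∀ k : ℕ, k + 1 ≤ n → p * w (k + 2) = p * w 2 := by
    intro k
    induction k with
    | zero => simp
    | succ k ih =>
      intro hk
      have h := hcomm (k + 2)
      rw [periodicDiff_of_two_le_of_le R b p (by omega) (by omega),
        periodicDiff_of_two_le_of_le R a p (by omega) (by omega)] at h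
      rw [← ih (by omega), h, mul_comm]
      congr 2
  have hlast : p * w 1 = p * w 2 := by
    rw [← key (n - 1) (by omega), ← hper 1]
    congr 2
    omega
  have h1 := hcomm 1
  rw [periodicDiff_one R hn, periodicDiff_one R hn, one_add_one_eq_two] at h1
  linear_combination h1 - a * hlast

/-- If `p * p = 0`, homotopic maps agree after multiplication by `p`. -/
theorem IsPeriodicHomotopic.mul_apply_eq {R : Type*} [CommRing R] {n : ℕ} {a b p : R}
    (hpp : p * p = 0) {φ ψ : ℤ → R}
    (h : IsPeriodicHomotopic R n (periodicDiff R n a p) (periodicDiff R n b p) φ ψ) (i : ℤ) :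
    p * φ i = p * ψ i := by
  obtain ⟨s, -, hs⟩ := h
  obtain ⟨x, hx⟩ := dvd_periodicDiff R n a p i
  obtain ⟨y, hy⟩ := dvd_periodicDiff R n b p (i - 1)
  have hi := hs i
  rw [hx, hy] at hi
  linear_combination p * hi + (s i * x + y * s (i - 1)) * hpp

/-- Let `R` be a commutative local ring whose maximal ideal is principal, generated by
`p ≠ 0`, with square zero, let `n ≥ 3` and let `u, v` be units of `R`.  The `n`-periodic
complexes `R(u)•` and `R(v)•` are `n`-periodically homotopy equivalent if and only if
`u * p = v * p`. -/
theorem periodic_complexes_homotopy_equivalent_iff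
    (R : Type*) [CommRing R] [IsLocalRing R] (p : R)
    (hp : maximalIdeal R = Ideal.span {p}) (hp0 : p ≠ 0)
    (hm2 : (maximalIdeal R) ^ 2 = ⊥)
    (n : ℕ) (hn : 3 ≤ n) (u v : Rˣ) :
    (∃ w w' : ℤ → R,
      IsPeriodicChainMap R n (periodicDiff R n (u : R) p) (periodicDiff R n (v : R) p) w ∧
      IsPeriodicChainMap R n (periodicDiff R n (v : R) p) (periodicDiff R n (u : R) p) w' ∧
      IsPeriodicHomotopic R n (periodicDiff R n (u : R) p) (periodicDiff R n (u : R) p)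
        (fun i => w' i * w i) (fun _ => 1) ∧
      IsPeriodicHomotopic R n (periodicDiff R n (v : R) p) (periodicDiff R n (v : R) p)
        (fun i => w i * w' i) (fun _ => 1)) ↔
    (u : R) * p = (v : R) * p := by
  have hpp : p * p = 0 := by
    have hmem : p ∈ maximalIdeal R := hp ▸ Ideal.mem_span_singleton_self p
    have h := Ideal.mul_mem_mul hmem hmem
    rwa [← pow_two, hm2, Ideal.mem_bot] at h
  constructor
  · rintro ⟨w, w', hw, -, hww', -⟩
    have h1 := hw.mul_apply_one (by omega)
    have h2 : p * (w' 1 * w 1) = p * 1 := hww'.mul_apply_eq hpp 1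
    linear_combination (v - u : R) * h2 - w' 1 * h1
  · intro h
    have hd : periodicDiff R n (u : R) p = periodicDiff R n (v : R) p := by
      unfold periodicDiff
      rw [h]
    rw [hd]
    refine ⟨fun _ => 1, fun _ => 1, ?_, ?_, ⟨fun _ => 0, ?_⟩, ⟨fun _ => 0, ?_⟩⟩ <;>
      simp [IsPeriodicChainMap]
end

section
/- Let k be a field, A a finite-dimensional k-algebra, σ a k-algebra automorphism of A, and n ≥ 1. Suppose there is an exact sequence of (A,A)-bimodules 0 → _1A_σ → P_n → P_{n−1} → ⋯ → P_1 → A → 0 in which each P_i is projective as an (A,A)-bimodule. Then for every positive integer m there is an exact sequence of (A,A)-bimodules 0 → _1A_{σ^m} → Q_{mn} → Q_{mn−1} → ⋯ → Q_1 → A → 0 in which each Q_i is projective as an (A,A)-bimodule. (Equivalently, Ω^n_{A^e}(A) ≅ _1A_σ implies Ω^{mn}_{A^e}(A) ≅ _1A_{σ^m}.) -/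
universe u

/-- An `(A,A)`-bimodule over the `k`-algebra `A` in which the two induced `k`-actions
agree (equivalently, a module over the enveloping algebra `A^e = A ⊗[k] Aᵐᵒᵖ`):
an abelian group together with a left and a right `A`-action which commute and agree
on the image of `k`. -/
structure KBimod (k A : Type u) [CommRing k] [Ring A] [Algebra k A] : Type (u + 1) where
  carrier : Type u
  [addCommGroup : AddCommGroup carrier]
  smulL : A → carrier → carrier
  smulR : A → carrier → carrier
  one_smulL : ∀ m, smulL 1 m = m
  mul_smulL : ∀ a b m, smulL (a * b) m = smulL a (smulL b m)
  smulL_add : ∀ a m m', smulL a (m + m') = smulL a m + smulL a m'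
  add_smulL : ∀ a b m, smulL (a + b) m = smulL a m + smulL b m
  one_smulR : ∀ m, smulR 1 m = m
  mul_smulR : ∀ a b m, smulR (a * b) m = smulR b (smulR a m)
  smulR_add : ∀ a m m', smulR a (m + m') = smulR a m + smulR a m'
  add_smulR : ∀ a b m, smulR (a + b) m = smulR a m + smulR b m
  smul_comm : ∀ a b m, smulL a (smulR b m) = smulR b (smulL a m)
  central : ∀ (c : k) (m), smulL (algebraMap k A c) m = smulR (algebraMap k A c) m

attribute [instance] KBimod.addCommGroup

namespace KBimod

variable {k A : Type u} [CommRing k] [Ring A] [Algebra k A]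

/-- A homomorphism of `(A,A)`-bimodules: an additive map commuting with both actions. -/
def IsHom (M N : KBimod k A) (f : M.carrier → N.carrier) : Prop :=
  (∀ m m', f (m + m') = f m + f m') ∧
  (∀ a m, f (M.smulL a m) = N.smulL a (f m)) ∧
  (∀ a m, f (M.smulR a m) = N.smulR a (f m))

/-- A bimodule is projective (as a module over the enveloping algebra `A^e`,
equivalently in the category of bimodules) if it has the lifting property against all
surjective bimodule homomorphisms. -/
def Proj (P : KBimod k A) : Prop :=
  ∀ (M N : KBimod k A) (g : M.carrier → N.carrier), IsHom M N g → Function.Surjective g →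
    ∀ f : P.carrier → N.carrier, IsHom P N f →
      ∃ h : P.carrier → M.carrier, IsHom P M h ∧ ∀ x, g (h x) = f x

/-- The regular bimodule `A`, with left and right actions given by multiplication. -/
def ofRing (k A : Type u) [CommRing k] [Ring A] [Algebra k A] : KBimod k A where
  carrier := A
  smulL a x := a * x
  smulR b x := x * b
  one_smulL := one_mul
  mul_smulL a b m := mul_assoc a b m
  smulL_add := mul_add
  add_smulL := fun a b m => add_mul a b m
  one_smulR := mul_one
  mul_smulR a b m := (mul_assoc m a b).symm
  smulR_add a m m' := add_mul m m' a
  add_smulR a b m := mul_add m a b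
  smul_comm a b m := (mul_assoc a m b).symm
  central c m := (Algebra.commutes c m)

/-- The twisted bimodule `_1A_σ`: the abelian group `A` with left action `a • x = a * x`
and right action `x • b = x * σ b`. -/
def twistR (σ : A ≃ₐ[k] A) : KBimod k A where
  carrier := A
  smulL a x := a * x
  smulR b x := x * σ b
  one_smulL := one_mul
  mul_smulL a b m := mul_assoc a b m
  smulL_add := mul_add
  add_smulL := fun a b m => add_mul a b m
  one_smulR m := by simp
  mul_smulR a b m := by simp [map_mul, mul_assoc]
  smulR_add a m m' := add_mul m m' (σ a)
  add_smulR a b m := by simp [map_add, mul_add]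
  smul_comm a b m := (mul_assoc a m (σ b)).symm
  central c m := by
    simp [AlgEquiv.commutes, Algebra.commutes]

/-- The left twist `M^{(σ)}` of a bimodule `M` by an automorphism `σ`: the same abelian
group and right action, with new left action `a ∘ m = σ a • m`.  Under the canonical
identification, `(_1A_{σ⁻¹}) ⊗_A M ≅ M^{(σ)}`. -/
def lTwist (σ : A ≃ₐ[k] A) (M : KBimod k A) : KBimod k A where
  carrier := M.carrier
  addCommGroup := M.addCommGroup
  smulL a m := M.smulL (σ a) m
  smulR := M.smulR
  one_smulL m := by simp [M.one_smulL]
  mul_smulL a b m := by simp [map_mul, M.mul_smulL]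
  smulL_add a m m' := M.smulL_add _ m m'
  add_smulL a b m := by simp [map_add, M.add_smulL]
  one_smulR := M.one_smulR
  mul_smulR := M.mul_smulR
  smulR_add := M.smulR_add
  add_smulR := M.add_smulR
  smul_comm a b m := M.smul_comm _ b m
  central c m := by
    simpa [AlgEquiv.commutes] using M.central c m

theorem IsHom.comp {L M N : KBimod k A} {g : M.carrier → N.carrier} {f : L.carrier → M.carrier}
    (hg : IsHom M N g) (hf : IsHom L M f) : IsHom L N (g ∘ f) := by
  refine ⟨fun x y => ?_, fun a x => ?_, fun a x => ?_⟩
  · simp only [Function.comp_apply, hf.1, hg.1]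
  · simp only [Function.comp_apply, hf.2.1, hg.2.1]
  · simp only [Function.comp_apply, hf.2.2, hg.2.2]

theorem IsHom.map_zero {M N : KBimod k A} {f : M.carrier → N.carrier} (hf : IsHom M N f) :
    f 0 = 0 := by
  simpa using hf.1 0 0

theorem IsHom.lTwist {M N : KBimod k A} {f : M.carrier → N.carrier} (hf : IsHom M N f)
    (τ : A ≃ₐ[k] A) : IsHom (KBimod.lTwist τ M) (KBimod.lTwist τ N) f :=
  ⟨hf.1, fun a x => hf.2.1 (τ a) x, hf.2.2⟩

theorem Proj.lTwist {P : KBimod k A} (hP : Proj P) (τ : A ≃ₐ[k] A) :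
    Proj (KBimod.lTwist τ P) := by
  intro M N g hg hgs f hf
  have hf' : IsHom P (KBimod.lTwist τ.symm N) f := by
    refine ⟨hf.1, fun a x => ?_, hf.2.2⟩
    have h := hf.2.1 (τ.symm a) x
    change f (P.smulL (τ (τ.symm a)) x) = _ at h
    rwa [τ.apply_symm_apply] at h
  obtain ⟨h, hh, hgh⟩ :=
    hP (KBimod.lTwist τ.symm M) (KBimod.lTwist τ.symm N) g (hg.lTwist τ.symm) hgs f hf'
  refine ⟨h, ⟨hh.1, fun a x => ?_, hh.2.2⟩, hgh⟩
  have h' := hh.2.1 (τ a) x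
  change _ = M.smulL (τ.symm (τ a)) (h x) at h'
  rwa [τ.symm_apply_apply] at h'

/-- `ProjRes N n X S` says that there is an exact sequence of bimodules
`0 → N → P_n → ⋯ → P_1 → X` with all `P_i` projective, in which the image of the last map
is `S`. -/
def ProjRes (N : KBimod k A) : ℕ → ∀ X : KBimod k A, Set X.carrier → Prop
  | 0, X, S => ∃ j : N.carrier → X.carrier,
      IsHom N X j ∧ Function.Injective j ∧ Set.range j = S
  | n + 1, X, S => ∃ (P : KBimod k A) (p : P.carrier → X.carrier),
      Proj P ∧ IsHom P X p ∧ Set.range p = S ∧ ProjRes N n P {x | p x = 0}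

theorem ProjRes.of_bijective {X N : KBimod k A} {e : N.carrier → X.carrier}
    (he : IsHom N X e) (hb : Function.Bijective e) : ProjRes N 0 X Set.univ :=
  ⟨e, he, hb.1, hb.2.range_eq⟩

theorem ProjRes.splice {N N' : KBimod k A} {n' : ℕ} (h' : ProjRes N' n' N Set.univ) :
    ∀ {n : ℕ} {X : KBimod k A} {S : Set X.carrier}, ProjRes N n X S → ProjRes N' (n' + n) X S
  | 0, X, S, ⟨j, hj, hinj, hS⟩ => by
    cases n' with
    | zero =>
      obtain ⟨i, hi, hi', hr⟩ := h'
      exact ⟨j ∘ i, hj.comp hi, hinj.comp hi', by rw [Set.range_comp, hr, Set.image_univ, hS]⟩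
    | succ n' =>
      obtain ⟨P, p, hP, hp, hr, hres⟩ := h'
      refine ⟨P, j ∘ p, hP, hj.comp hp, by rw [Set.range_comp, hr, Set.image_univ, hS], ?_⟩
      have hker : {x | (j ∘ p) x = 0} = {x | p x = 0} := by
        ext x
        exact hinj.eq_iff' hj.map_zero
      rw [hker]
      exact hres
  | _ + 1, _, _, ⟨P, p, hP, hp, hr, hres⟩ => ⟨P, p, hP, hp, hr, h'.splice hres⟩

theorem ProjRes.lTwist {N : KBimod k A} (τ : A ≃ₐ[k] A) :
    ∀ {n : ℕ} {X : KBimod k A} {S : Set X.carrier}, ProjRes N n X S →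
      ProjRes (KBimod.lTwist τ N) n (KBimod.lTwist τ X) S
  | 0, _, _, ⟨j, hj, hinj, hS⟩ => ⟨j, hj.lTwist τ, hinj, hS⟩
  | _ + 1, _, _, ⟨P, p, hP, hp, hr, hres⟩ =>
    ⟨KBimod.lTwist τ P, p, hP.lTwist τ, hp.lTwist τ, hr, hres.lTwist τ⟩

theorem ProjRes.of_sequence {N : KBimod k A} {n : ℕ} (P : ℕ → KBimod k A)
    (f : ∀ i : ℕ, (P (i + 1)).carrier → (P i).carrier) (e : N.carrier → (P (n + 1)).carrier)
    (he : IsHom N (P (n + 1)) e) (hb : Function.Bijective e)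
    (hf : ∀ i, i ≤ n → IsHom (P (i + 1)) (P i) (f i)) (hinj : Function.Injective (f n))
    (hex : ∀ i, i + 1 ≤ n → Function.Exact (f (i + 1)) (f i))
    (hproj : ∀ i, 1 ≤ i → i ≤ n → Proj (P i)) :
    ProjRes N n (P 0) (Set.range (f 0)) := by
  induction n generalizing P with
  | zero => exact ⟨f 0 ∘ e, (hf 0 le_rfl).comp he, hinj.comp hb.1, hb.2.range_comp (f 0)⟩
  | succ n ih =>
    refine ⟨P 1, f 0, hproj 1 le_rfl (by omega), hf 0 (by omega), rfl, ?_⟩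
    have hker : {x | f 0 x = 0} = Set.range (f 1) := Set.ext (hex 0 (by omega))
    rw [hker]
    exact ih (fun i => P (i + 1)) (fun i => f (i + 1)) e he hb
      (fun i hi => hf (i + 1) (by omega)) hinj (fun i hi => hex (i + 1) (by omega))
      (fun i _ hi => hproj (i + 1) (by omega) (by omega))

/-- The sequence of bimodules `X, R 0, R 1, …`. -/
def seqCons (X : KBimod k A) (R : ℕ → KBimod k A) : ℕ → KBimod k A
  | 0 => X
  | i + 1 => R i

theorem ProjRes.exists_sequence {N : KBimod k A} {n : ℕ} {X : KBimod k A} {S : Set X.carrier}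
    (h : ProjRes N n X S) :
    ∃ (R : ℕ → KBimod k A)
      (g : ∀ i : ℕ, (seqCons X R (i + 1)).carrier → (seqCons X R i).carrier)
      (e : N.carrier → (R n).carrier),
      IsHom N (R n) e ∧ Function.Bijective e ∧
      (∀ i, i ≤ n → IsHom (seqCons X R (i + 1)) (seqCons X R i) (g i)) ∧
      Function.Injective (g n) ∧ Set.range (g 0) = S ∧
      (∀ i, i + 1 ≤ n → Function.Exact (g (i + 1)) (g i)) ∧
      ∀ i, i < n → Proj (R i) := by
  induction n generalizing X with
  | zero =>
    obtain ⟨j, hj, hinj, hS⟩ := h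
    refine ⟨fun _ => N, fun | 0 => j | _ + 1 => id, id,
      ⟨fun _ _ => rfl, fun _ _ => rfl, fun _ _ => rfl⟩, Function.bijective_id, ?_, hinj, hS,
      fun i hi => by omega, fun i hi => by omega⟩
    intro i hi
    obtain rfl : i = 0 := by omega
    exact hj
  | succ n ih =>
    obtain ⟨P, p, hP, hp, hr, hres⟩ := h
    obtain ⟨R, g, e, he, hb, hg, hinj, hrange, hex, hproj⟩ := ih hres
    refine ⟨seqCons P R, fun | 0 => p | i + 1 => g i, e, he, hb, ?_, hinj, hr, ?_, ?_⟩
    · rintro (_ | i) hi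
      · exact hp
      · exact hg i (by omega)
    · rintro (_ | i) hi
      · exact fun x => (Set.ext_iff.1 hrange x).symm
      · exact hex i (by omega)
    · rintro (_ | i) hi
      · exact hP
      · exact hproj i (by omega)

theorem isHom_lTwist_ofRing (τ : A ≃ₐ[k] A) :
    IsHom (lTwist τ (ofRing k A)) (twistR τ⁻¹) (τ.symm : A → A) := by
  refine ⟨fun x y => map_add τ.symm x y, fun (a x : A) => ?_, fun (a x : A) => map_mul τ.symm x a⟩
  exact (map_mul τ.symm (τ a) x).trans
    (congrArg (fun y : A => y * τ.symm x) (τ.symm_apply_apply a))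

theorem isHom_lTwist_twistR (σ τ : A ≃ₐ[k] A) :
    IsHom (twistR (τ⁻¹ * σ)) (lTwist τ (twistR σ)) (τ : A → A) := by
  refine ⟨fun x y => map_add τ x y, fun (a x : A) => map_mul τ a x, fun (a x : A) => ?_⟩
  exact (map_mul τ x (τ.symm (σ a))).trans
    (congrArg (fun y : A => τ x * y) (τ.apply_symm_apply (σ a)))

theorem ProjRes.twistR_mul {σ : A ≃ₐ[k] A} {n : ℕ}
    (h : ProjRes (twistR σ) n (ofRing k A) Set.univ) (τ : A ≃ₐ[k] A) :
    ProjRes (twistR (τ * σ)) n (twistR τ) Set.univ := by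
  have hleft := (h.lTwist τ⁻¹).splice
    (.of_bijective (isHom_lTwist_ofRing τ⁻¹) τ⁻¹.symm.bijective)
  have hright := ProjRes.of_bijective (isHom_lTwist_twistR σ τ⁻¹) τ⁻¹.bijective
  have hres := hright.splice hleft
  rwa [inv_inv, zero_add, add_zero] at hres

theorem ProjRes.twistR_pow {σ : A ≃ₐ[k] A} {n : ℕ}
    (h : ProjRes (twistR σ) n (ofRing k A) Set.univ) (m : ℕ) :
    ProjRes (twistR (σ ^ m)) (m * n) (ofRing k A) Set.univ := by
  induction m with
  | zero =>
    rw [zero_mul, pow_zero]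
    exact .of_bijective (e := id) ⟨fun _ _ => rfl, fun _ _ => rfl, fun _ _ => rfl⟩
      Function.bijective_id
  | succ m ih =>
    rw [add_one_mul, add_comm (m * n), pow_succ]
    exact (h.twistR_mul (σ ^ m)).splice ih

end KBimod

/-- Let `k` be a field, `A` a finite-dimensional `k`-algebra, `σ` a `k`-algebra
automorphism of `A` and `n ≥ 1`.  Given an exact sequence of `(A,A)`-bimodules
`0 → _1A_σ → P n → ⋯ → P 1 → A → 0` (encoded as a family `P 0, …, P (n+1)` with bimodule
maps `f i : P (i+1) → P i`, bimodule isomorphisms `eN : _1A_σ ≅ P (n+1)` and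
`e0 : P 0 ≅ A` identifying the two end terms, injective `f n`, surjective `f 0` and
exactness at the middle terms) with each `P i` (`1 ≤ i ≤ n`) projective as a bimodule,
then for every positive integer `m` there is an exact sequence of `(A,A)`-bimodules
`0 → _1A_{σ^m} → Q (m*n) → ⋯ → Q 1 → A → 0` (encoded in the same way) in which each
`Q i` (`1 ≤ i ≤ m*n`) is projective as a bimodule.  Equivalently,
`Ω^n_{A^e}(A) ≅ _1A_σ` implies `Ω^{mn}_{A^e}(A) ≅ _1A_{σ^m}`. -/
theorem iterated_twisted_bimodule_resolution {k A : Type u} [Field k] [Ring A]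
    [Algebra k A] [FiniteDimensional k A] (σ : A ≃ₐ[k] A) (n : ℕ) (hn : 1 ≤ n)
    (P : ℕ → KBimod k A)
    (f : ∀ i : ℕ, (P (i + 1)).carrier → (P i).carrier)
    (eN : A → (P (n + 1)).carrier) (e0 : (P 0).carrier → A)
    (heN : KBimod.IsHom (KBimod.twistR σ) (P (n + 1)) eN)
    (heNbij : Function.Bijective eN)
    (he0 : KBimod.IsHom (P 0) (KBimod.ofRing k A) e0)
    (he0bij : Function.Bijective e0)
    (hf : ∀ i, i ≤ n → KBimod.IsHom (P (i + 1)) (P i) (f i))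
    (hinj : Function.Injective (f n))
    (hsurj : Function.Surjective (f 0))
    (hex : ∀ i, i + 1 ≤ n → Function.Exact (f (i + 1)) (f i))
    (hproj : ∀ i, 1 ≤ i → i ≤ n → KBimod.Proj (P i)) :
    ∀ m : ℕ, 1 ≤ m →
      ∃ (Q : ℕ → KBimod k A)
        (g : ∀ i : ℕ, (Q (i + 1)).carrier → (Q i).carrier)
        (eN' : A → (Q (m * n + 1)).carrier) (e0' : (Q 0).carrier → A),
        KBimod.IsHom (KBimod.twistR (σ ^ m)) (Q (m * n + 1)) eN' ∧
        Function.Bijective eN' ∧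
        KBimod.IsHom (Q 0) (KBimod.ofRing k A) e0' ∧
        Function.Bijective e0' ∧
        (∀ i, i ≤ m * n → KBimod.IsHom (Q (i + 1)) (Q i) (g i)) ∧
        Function.Injective (g (m * n)) ∧
        Function.Surjective (g 0) ∧
        (∀ i, i + 1 ≤ m * n → Function.Exact (g (i + 1)) (g i)) ∧
        (∀ i, 1 ≤ i → i ≤ m * n → KBimod.Proj (Q i)) := by
  intro m _
  have h : KBimod.ProjRes (KBimod.twistR σ) n (KBimod.ofRing k A) Set.univ := by
    have h₁ := KBimod.ProjRes.of_sequence (N := KBimod.twistR σ) P f eN heN heNbij hf hinj hex hproj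
    rw [hsurj.range_eq] at h₁
    exact h₁.splice (.of_bijective he0 he0bij)
  obtain ⟨R, g, e, he, hb, hg, hginj, hrange, hgex, hgproj⟩ := (h.twistR_pow m).exists_sequence
  refine ⟨KBimod.seqCons (KBimod.ofRing k A) R, g, e, id, he, hb,
    ⟨fun _ _ => rfl, fun _ _ => rfl, fun _ _ => rfl⟩, Function.bijective_id, hg, hginj,
    Set.range_eq_univ.1 hrange, hgex, ?_⟩
  rintro (_ | i) hi hi'
  · omega
  · exact hgproj i (by omega)
end
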